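/- arXiv:0907.2430 — 7 statements merged into one kernel-verified Lean document; each statement's English description precedes it below -/
import Mathlib

section
/- Let s be a binary sequence in which both letters 0 and 1 occur. Then the following are equivalent: (a) for every k ≥ 1 and every factor w of s of length k, the length-k prefix of 0·s is lexicographically ≤ w and w is lexicographically ≤ the length-k prefix of 1·s (i.e., 0·s ≤ min(s) ≤ max(s) ≤ 1·s); (b) there exists a real number α ∈ (0,1) such that either s(n) = ⌊(n+2)α⌋ − ⌊(n+1)α⌋ for all n ≥ 0, or s(n) = ⌈(n+2)α⌉ − ⌈(n+1)α⌉ for all n ≥ 0. (For irrational α these sequences are the characteristic Sturmian sequences; for rational α they are the characteristic periodic balanced sequences.) -/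
/-- The finite word `s(i) s(i+1) ⋯ s(i+k−1)`. -/
def window {A : Type*} (s : ℕ → A) (i k : ℕ) : List A :=
  (List.range k).map fun j => s (i + j)

/-- `l` is a factor of the sequence `s`. -/
def IsFactor {A : Type*} (s : ℕ → A) (l : List A) : Prop :=
  ∃ i, l = window s i l.length

/-- The number of distinct factors of `s` of length `k` (complexity function). -/
noncomputable def complexity {A : Type*} (s : ℕ → A) (k : ℕ) : ℕ :=
  Set.ncard {l : List A | l.length = k ∧ IsFactor s l}

/-- The shift map. -/
def shiftMap {A : Type*} (s : ℕ → A) : ℕ → A := fun n => s (n + 1)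

/-- The sequence `x·u`. -/
def pre {A : Type*} (x : A) (u : ℕ → A) : ℕ → A
  | 0 => x
  | n + 1 => u n

/-- Strict lexicographic order on sequences. -/
def SeqLt {A : Type*} [LT A] (u v : ℕ → A) : Prop :=
  ∃ i, (∀ j < i, u j = v j) ∧ u i < v i

/-- Lexicographic order on sequences. -/
def SeqLe {A : Type*} [LT A] (u v : ℕ → A) : Prop :=
  (∀ n, u n = v n) ∨ SeqLt u v

/-- Lexicographic order on (equal-length) finite words. -/
def WordLe {A : Type*} [LT A] (u v : List A) : Prop :=
  u = v ∨ List.Lex (· < ·) u v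

def UltimatelyPeriodic {A : Type*} (s : ℕ → A) : Prop :=
  ∃ N, ∃ q ≥ 1, ∀ n ≥ N, s (n + q) = s n

/-- A binary sequence is Sturmian if it has complexity `k + 1` for all `k ≥ 1`. -/
def Sturmian (s : ℕ → Fin 2) : Prop :=
  ∀ k ≥ 1, complexity s k = k + 1

/-- `w` is a left special factor of `s`. -/
def LeftSpecial {A : Type*} (s : ℕ → A) (w : List A) : Prop :=
  ∃ x y : A, x ≠ y ∧ IsFactor s (x :: w) ∧ IsFactor s (y :: w)

/-- A binary sequence is balanced. -/
def BalancedSeq (s : ℕ → Fin 2) : Prop :=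
  ∀ u v : List (Fin 2), IsFactor s u → IsFactor s v → u.length = v.length →
    ((u.count 1 : ℤ) - (v.count 1 : ℤ)).natAbs ≤ 1

/-- `u` is the characteristic Sturmian sequence of slope `α`. -/
def IsCharSturmian (α : ℝ) (u : ℕ → Fin 2) : Prop :=
  ∀ n : ℕ, ((u n : ℕ) : ℤ) = ⌊((n : ℝ) + 2) * α⌋ - ⌊((n : ℝ) + 1) * α⌋

lemma window_succ' {A : Type*} (s : ℕ → A) (i k : ℕ) :
    window s i (k+1) = s i :: window s (i+1) k := by
  simp only [window, List.range_succ_eq_map, List.map_cons, List.map_map, Nat.add_zero]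
  congr 1
  apply List.map_congr_left
  intro j _
  simp only [Function.comp, Nat.succ_eq_add_one]
  congr 1
  omega

lemma wordLe_cons (a b : Fin 2) (l l' : List (Fin 2)) :
    WordLe (a :: l) (b :: l') ↔ a < b ∨ (a = b ∧ WordLe l l') := by
  unfold WordLe
  rw [List.cons_lex_cons_iff, List.cons.injEq]
  tauto

/-- prefix sums of a shifted sequence -/
def PS (u : ℕ → Fin 2) (i m : ℕ) : ℤ := ∑ j ∈ Finset.range m, (((u (i + j) : Fin 2) : ℕ) : ℤ)

lemma PS_zero (u : ℕ → Fin 2) (i : ℕ) : PS u i 0 = 0 := by simp [PS]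

lemma PS_add (u : ℕ → Fin 2) (i a b : ℕ) : PS u i (a + b) = PS u i a + PS u (i + a) b := by
  unfold PS
  rw [Finset.sum_range_add]
  simp only [add_assoc]

lemma PS_one (u : ℕ → Fin 2) (i : ℕ) : PS u i 1 = ((u i : ℕ) : ℤ) := by simp [PS]

lemma PS_head (u : ℕ → Fin 2) (i m : ℕ) : PS u i (m+1) = ((u i : ℕ) : ℤ) + PS u (i+1) m := by
  rw [add_comm m 1, PS_add, PS_one]

lemma PS_succ (u : ℕ → Fin 2) (i m : ℕ) : PS u i (m+1) = PS u i m + ((u (i + m) : ℕ) : ℤ) := by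
  rw [PS_add, PS_one]

lemma PS_pre (x : Fin 2) (s : ℕ → Fin 2) (m : ℕ) :
    PS (pre x s) 0 (m+1) = ((x : ℕ) : ℤ) + PS s 0 m := by
  rw [PS_head]
  congr 1
  unfold PS
  apply Finset.sum_congr rfl
  intro j _
  rw [zero_add, zero_add, add_comm 1 j]
  rfl

lemma wordLe_of_PS (u v : ℕ → Fin 2) (k : ℕ) : ∀ i i' : ℕ,
    (∀ m ≤ k, PS u i m ≤ PS v i' m) → WordLe (window u i k) (window v i' k) := by
  induction k with
  | zero => intro i i' _; left; simp [window]
  | succ k ih =>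
    intro i i' h
    rw [window_succ', window_succ', wordLe_cons]
    have h1 := h 1 (by omega)
    rw [PS_one, PS_one] at h1
    rcases lt_or_ge (u i) (v i') with hlt | hge
    · exact Or.inl hlt
    · have he : u i = v i' := by
        apply le_antisymm _ hge
        rw [Fin.le_def]; exact_mod_cast h1
      refine Or.inr ⟨he, ih _ _ ?_⟩
      intro m hm
      have := h (m+1) (by omega)
      rw [PS_head, PS_head, he] at this
      linarith

lemma PS_of_wordLe (u v : ℕ → Fin 2) (k : ℕ) : ∀ i i' : ℕ,
    WordLe (window u i k) (window v i' k) →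
    PS u i k = PS v i' k ∨ ∃ j < k, PS u i (j+1) + 1 = PS v i' (j+1) := by
  induction k with
  | zero => intro i i' _; left; simp [PS_zero]
  | succ k ih =>
    intro i i' h
    rw [window_succ', window_succ', wordLe_cons] at h
    rcases h with h | ⟨he, h⟩
    · right
      refine ⟨0, by omega, ?_⟩
      rw [zero_add, PS_one, PS_one]
      have := Fin.lt_def.mp h
      have := (v i').isLt
      omega
    · rcases ih _ _ h with h | ⟨j, hj, h⟩
      · left; rw [PS_head, PS_head, he, h]
      · right
        refine ⟨j+1, by omega, ?_⟩
        rw [PS_head u i, PS_head v i', he, ← h]; ring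

lemma bal (s : ℕ → Fin 2)
    (h : ∀ k ≥ 1, ∀ w : List (Fin 2), w.length = k → IsFactor s w →
        WordLe (window (pre 0 s) 0 k) w ∧ WordLe w (window (pre 1 s) 0 k)) :
    ∀ m i : ℕ, PS s 0 m ≤ PS s i (m+1) ∧ PS s i (m+1) ≤ PS s 0 m + 1 := by
  intro m
  induction m using Nat.strong_induction_on with
  | _ m ih =>
    intro i
    have hl : (window s i (m+1)).length = m+1 := by simp [window]
    obtain ⟨ha, hb⟩ := h (m+1) (by omega) (window s i (m+1)) hl ⟨i, by rw [hl]⟩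
    have key : ∀ j, j < m → PS s i (m+1) = PS s i (j+1) + PS s (i+(j+1)) (m-1-j+1) ∧
        PS s 0 m = PS s 0 j + PS s j (m-1-j+1) := by
      intro j hj
      constructor
      · rw [← PS_add]; congr 1; omega
      · have := PS_add s 0 j (m-1-j+1)
        rw [zero_add] at this
        rw [← this]; congr 1; omega
    constructor
    · rcases PS_of_wordLe _ _ _ _ _ ha with h | ⟨j, hj, h⟩
      · rw [PS_pre] at h; simp at h; omega
      · rw [PS_pre] at h; simp at h
        rcases Nat.lt_or_ge j m with hjm | hjm
        · have k1 := key j hjm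
          have k2 := ih (m-1-j) (by omega) (i+(j+1))
          have k3 := ih (m-1-j) (by omega) j
          omega
        · obtain rfl : j = m := by omega
          omega
    · rcases PS_of_wordLe _ _ _ _ _ hb with h | ⟨j, hj, h⟩
      · rw [PS_pre] at h; simp at h; omega
      · rw [PS_pre] at h; simp at h
        rcases Nat.lt_or_ge j m with hjm | hjm
        · have k1 := key j hjm
          have k2 := ih (m-1-j) (by omega) (i+(j+1))
          have k3 := ih (m-1-j) (by omega) j
          omega
        · obtain rfl : j = m := by omega
          omega

lemma supF_mul (F : ℕ → ℤ) (h : ∀ a b, 1 ≤ a → 1 ≤ b → F a + F b ≤ F (a+b)) (n : ℕ) (hn : 1 ≤ n)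
    (m : ℕ) (hm : 1 ≤ m) : (m : ℤ) * F n ≤ F (m * n) := by
  induction m, hm using Nat.le_induction with
  | base => simp
  | succ m hm ih =>
    have := h (m*n) n (Nat.mul_pos hm hn) hn
    rw [add_mul, one_mul]; push_cast; linarith

lemma subF_mul (F : ℕ → ℤ) (h : ∀ a b, 1 ≤ a → 1 ≤ b → F (a+b) ≤ F a + F b + 1) (n : ℕ)
    (hn : 1 ≤ n) (m : ℕ) (hm : 1 ≤ m) : F (m * n) + 1 ≤ (m : ℤ) * (F n + 1) := by
  induction m, hm using Nat.le_induction with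
  | base => simp
  | succ m hm ih =>
    have := h (m*n) n (Nat.mul_pos hm hn) hn
    rw [add_mul, one_mul]; push_cast; linarith

lemma slopeF (F : ℕ → ℤ) (h : ∀ a b, 1 ≤ a → 1 ≤ b → F a + F b ≤ F (a+b))
    (h' : ∀ a b, 1 ≤ a → 1 ≤ b → F (a+b) ≤ F a + F b + 1) :
    ∃ α : ℝ, (∀ n : ℕ, 1 ≤ n → (F n : ℝ) ≤ n * α ∧ n * α ≤ F n + 1) ∧
      ((∀ n : ℕ, 1 ≤ n → F n = ⌊(n : ℝ) * α⌋) ∨ (∀ n : ℕ, 1 ≤ n → F n + 1 = ⌈(n : ℝ) * α⌉)) := by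
  have key : ∀ n m : ℕ, 1 ≤ n → 1 ≤ m → (m : ℤ) * F n + 1 ≤ n * (F m + 1) := by
    intro n m hn hm
    have h1 := supF_mul F h n hn m hm
    have h2 := subF_mul F h' m hm n hn
    rw [mul_comm n m] at h2
    linarith
  have keyR : ∀ n m : ℕ, 1 ≤ n → 1 ≤ m → (F n : ℝ) / n ≤ (F m + 1) / m := by
    intro n m hn hm
    rw [div_le_div_iff₀ (by exact_mod_cast hn) (by exact_mod_cast hm)]
    have := key n m hn hm
    have h3 : (m : ℝ) * F n + 1 ≤ n * (F m + 1) := by exact_mod_cast this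
    linarith
  let A : Set ℝ := {x | ∃ n : ℕ, 1 ≤ n ∧ x = (F n : ℝ) / n}
  have hb : BddAbove A := ⟨(F 1 + 1) / (1:ℕ), by rintro x ⟨n, hn, rfl⟩; exact keyR n 1 hn le_rfl⟩
  have hα : ∀ n : ℕ, 1 ≤ n → (F n : ℝ) ≤ n * sSup A ∧ n * sSup A ≤ F n + 1 := by
    intro n hn
    have hn0 : (0:ℝ) < n := by exact_mod_cast hn
    constructor
    · have : (F n : ℝ) / n ≤ sSup A := le_csSup hb ⟨n, hn, rfl⟩
      rw [div_le_iff₀ hn0] at this; linarith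
    · have : sSup A ≤ (F n + 1 : ℝ) / n := by
        refine csSup_le (s := A) ⟨_, 1, le_rfl, rfl⟩ ?_
        rintro x ⟨m, hm, rfl⟩; exact keyR m n hm hn
      rw [le_div_iff₀ hn0] at this; linarith
  refine ⟨sSup A, hα, ?_⟩
  generalize sSup A = α at hα
  by_cases hc : ∀ n : ℕ, 1 ≤ n → (n : ℝ) * α ≠ F n + 1
  · left
    intro n hn
    symm
    rw [Int.floor_eq_iff]
    exact ⟨(hα n hn).1, lt_of_le_of_ne (hα n hn).2 (hc n hn)⟩
  · right
    push Not at hc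
    obtain ⟨n, hn, hnα⟩ := hc
    intro m hm
    symm
    rw [Int.ceil_eq_iff]
    push_cast
    refine ⟨?_, (hα m hm).2⟩
    rw [add_sub_cancel_right]
    apply lt_of_le_of_ne (hα m hm).1
    intro he
    have := key m n hm hn
    have h3 : (n : ℝ) * F m + 1 ≤ m * (F n + 1) := by exact_mod_cast this
    rw [he, ← hnα] at h3
    linarith

/-- For a binary sequence in which both letters occur, `0·s ≤ min(s) ≤ max(s) ≤ 1·s`
holds iff `s` is a characteristic Sturmian sequence (irrational slope) or a
characteristic periodic balanced sequence (rational slope), i.e. iff there is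
`α ∈ (0,1)` with `s(n) = ⌊(n+2)α⌋ − ⌊(n+1)α⌋` for all `n`, or
`s(n) = ⌈(n+2)α⌉ − ⌈(n+1)α⌉` for all `n`. -/
theorem stmt8 (s : ℕ → Fin 2) (h0 : ∃ n, s n = 0) (h1 : ∃ n, s n = 1) :
    (∀ k ≥ 1, ∀ w : List (Fin 2), w.length = k → IsFactor s w →
        WordLe (window (pre 0 s) 0 k) w ∧ WordLe w (window (pre 1 s) 0 k)) ↔
    (∃ α ∈ Set.Ioo (0 : ℝ) 1,
        (∀ n : ℕ, ((s n : ℕ) : ℤ) = ⌊((n : ℝ) + 2) * α⌋ - ⌊((n : ℝ) + 1) * α⌋) ∨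
        (∀ n : ℕ, ((s n : ℕ) : ℤ) = ⌈((n : ℝ) + 2) * α⌉ - ⌈((n : ℝ) + 1) * α⌉)) := by
  constructor
  · intro h
    have hb := bal s h
    obtain ⟨α, hα, hα'⟩ := slopeF (fun n => PS s 0 (n-1))
      (by
        intro a b ha hb'
        obtain ⟨a, rfl⟩ := Nat.exists_eq_add_of_le' ha
        obtain ⟨b, rfl⟩ := Nat.exists_eq_add_of_le' hb'
        have := hb b a
        have e := PS_add s 0 a (b+1)
        have e2 : a + 1 + (b + 1) - 1 = a + (b+1) := by omega
        simp only [e2, Nat.add_sub_cancel]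
        rw [zero_add] at e
        omega)
      (by
        intro a b ha hb'
        obtain ⟨a, rfl⟩ := Nat.exists_eq_add_of_le' ha
        obtain ⟨b, rfl⟩ := Nat.exists_eq_add_of_le' hb'
        have := hb b a
        have e := PS_add s 0 a (b+1)
        have e2 : a + 1 + (b + 1) - 1 = a + (b+1) := by omega
        simp only [e2, Nat.add_sub_cancel]
        rw [zero_add] at e
        omega)
    have hnn : ∀ m, 0 ≤ PS s 0 m := fun m => Finset.sum_nonneg (fun _ _ => by positivity)
    have hle : ∀ m, PS s 0 m ≤ m := by
      intro m
      induction m with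
      | zero => simp [PS_zero]
      | succ m ih =>
        have := (s (0+m)).isLt
        rw [PS_succ]; push_cast; omega
    have p0 : 0 < α := by
      obtain ⟨n, hn⟩ := h1
      have h2 := (hα (n+2) (by omega)).1
      have h3 : (1:ℤ) ≤ PS s 0 (n+1) := by
        rw [PS_succ, zero_add, hn]
        have := hnn n
        simpa using this
      have e : n + 2 - 1 = n + 1 := rfl
      simp only [e] at h2
      have h4 : (1:ℝ) ≤ (PS s 0 (n+1) : ℝ) := by exact_mod_cast h3
      by_contra hneg
      push Not at hneg
      have : ((n+2 : ℕ) : ℝ) * α ≤ 0 := mul_nonpos_of_nonneg_of_nonpos (by positivity) hneg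
      linarith
    have p1 : α < 1 := by
      obtain ⟨n, hn⟩ := h0
      have h2 := (hα (n+2) (by omega)).2
      have h3 : PS s 0 (n+1) ≤ n := by
        rw [PS_succ, zero_add, hn]
        have := hle n
        simpa using this
      have e : n + 2 - 1 = n + 1 := rfl
      simp only [e] at h2
      have h4 : (PS s 0 (n+1) : ℝ) ≤ n := by exact_mod_cast h3
      push_cast at h2
      by_contra hneg
      push Not at hneg
      nlinarith
    refine ⟨α, ⟨p0, p1⟩, ?_⟩
    rcases hα' with hf | hf
    · left
      intro n
      have f1 := hf (n+2) (by omega)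
      have f2 := hf (n+1) (by omega)
      have e : n + 2 - 1 = n + 1 := rfl
      simp only [e, Nat.add_sub_cancel, PS_succ, zero_add] at f1 f2
      push_cast at f1 f2
      linarith
    · right
      intro n
      have f1 := hf (n+2) (by omega)
      have f2 := hf (n+1) (by omega)
      have e : n + 2 - 1 = n + 1 := rfl
      simp only [e, Nat.add_sub_cancel, PS_succ, zero_add] at f1 f2
      push_cast at f1 f2
      linarith
  · rintro ⟨α, ⟨p0, p1⟩, hα⟩ k hk w hw ⟨i, hi⟩
    rw [hw] at hi
    subst hi
    have main : ∀ m, PS s 0 m ≤ PS s i (m+1) ∧ PS s i (m+1) ≤ PS s 0 m + 1 := by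
      rcases hα with hα | hα
      · have e : ∀ i m : ℕ, PS s i m = ⌊((i:ℝ)+m+1)*α⌋ - ⌊((i:ℝ)+1)*α⌋ := by
          intro i m
          induction m with
          | zero => simp [PS_zero]
          | succ m ih =>
            rw [PS_succ, ih, hα]; push_cast
            have e1 : ((i:ℝ)+m+2) = (i:ℝ)+(m+1)+1 := by ring
            rw [e1]; ring
        have z : ⌊α⌋ = 0 := by rw [Int.floor_eq_iff]; constructor <;> simp <;> linarith
        intro m
        rw [e, e]
        push_cast
        have e2 : ((i:ℝ)+(m+1)+1)*α = (m+1)*α + (i+1)*α := by ring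
        rw [e2]
        simp only [zero_add, one_mul, z]
        have a1 := Int.le_floor_add ((m+1)*α) (((i:ℝ)+1)*α)
        have a2 := Int.le_floor_add_floor ((m+1)*α) (((i:ℝ)+1)*α)
        omega
      · have e : ∀ i m : ℕ, PS s i m = ⌈((i:ℝ)+m+1)*α⌉ - ⌈((i:ℝ)+1)*α⌉ := by
          intro i m
          induction m with
          | zero => simp [PS_zero]
          | succ m ih =>
            rw [PS_succ, ih, hα]; push_cast
            have e1 : ((i:ℝ)+m+2) = (i:ℝ)+(m+1)+1 := by ring
            rw [e1]; ring
        have z : ⌈α⌉ = 1 := by rw [Int.ceil_eq_iff]; constructor <;> simp <;> linarith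
        intro m
        rw [e, e]
        push_cast
        have e2 : ((i:ℝ)+(m+1)+1)*α = (m+1)*α + (i+1)*α := by ring
        rw [e2]
        simp only [zero_add, one_mul, z]
        have a1 := Int.ceil_add_le ((m+1)*α) (((i:ℝ)+1)*α)
        have a2 := Int.ceil_add_ceil_le ((m+1)*α) (((i:ℝ)+1)*α)
        omega
    constructor
    · apply wordLe_of_PS
      intro m _
      cases m with
      | zero => simp [PS_zero]
      | succ m => rw [PS_pre]; simpa using (main m).1
    · apply wordLe_of_PS
      intro m _
      cases m with
      | zero => simp [PS_zero]
      | succ m => rw [PS_pre]; have := (main m).2; simp; omega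
end

section
/- Let α ∈ (0,1) be irrational and let c_α be the characteristic Sturmian sequence of slope α, c_α(n) = ⌊(n+2)α⌋ − ⌊(n+1)α⌋. Then for all i ≥ 1, 0·c_α < T^i(0·c_α) and T^i(1·c_α) < 1·c_α in the lexicographic order; in particular, for all i ≥ 0, 0·c_α < T^i(c_α) < 1·c_α. -/
theorem aux_lt (u v : ℕ → Fin 2) (U V : ℕ → ℤ) (h0 : U 0 = V 0)
    (hu : ∀ n, ((u n : ℕ) : ℤ) = U (n+1) - U n) (hv : ∀ n, ((v n : ℕ) : ℤ) = V (n+1) - V n)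
    (hle : ∀ n, U n ≤ V n) (hne : ∃ n, U n ≠ V n) : SeqLt u v := by
  classical
  have hs := Nat.find_spec hne
  have hm := fun m => Nat.find_min hne (m := m)
  generalize Nat.find hne = n at hs hm
  cases n with
  | zero => exact absurd h0 hs
  | succ k =>
    refine ⟨k, fun j hj => ?_, ?_⟩
    · have h1 := not_not.1 (hm j (by omega))
      have h2 := not_not.1 (hm (j+1) (by omega))
      have := hu j
      have := hv j
      apply Fin.ext
      omega
    · have h1 := not_not.1 (hm k (by omega))
      have := hu k
      have := hv k
      have := hle (k+1)
      rw [Fin.lt_def]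
      omega

theorem shift_iter {A : Type*} (i : ℕ) : ∀ (s : ℕ → A) (n : ℕ), (shiftMap^[i] s) n = s (n + i) := by
  induction i with
  | zero => intro s n; rfl
  | succ k ih =>
    intro s n
    rw [Function.iterate_succ_apply, ih]
    rfl

theorem aux_main (α : ℝ) (hirr : Irrational α)
    (c : ℕ → Fin 2) (hc : IsCharSturmian α c) (hα : α ∈ Set.Ioo (0 : ℝ) 1) (i : ℕ) :
    SeqLt (pre 0 c) (shiftMap^[i] c) ∧ SeqLt (shiftMap^[i] c) (pre 1 c) := by
  have hα0 : ⌊α⌋ = 0 := Int.floor_eq_zero_iff.2 ⟨hα.1.le, hα.2⟩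
  have hv : ∀ n, (((shiftMap^[i] c) n : ℕ) : ℤ) =
      (⌊(((n+1 : ℕ) : ℝ) + (i+1)) * α⌋ - ⌊((i:ℝ)+1)*α⌋) - (⌊((n : ℝ) + (i+1)) * α⌋ - ⌊((i:ℝ)+1)*α⌋) := by
    intro n
    rw [shift_iter, hc]
    push_cast
    ring_nf
  have hle : ∀ n : ℕ, ⌊(n:ℝ)*α⌋ ≤ ⌊((n : ℝ) + (i+1)) * α⌋ - ⌊((i:ℝ)+1)*α⌋ ∧
     ⌊((n : ℝ) + (i+1)) * α⌋ - ⌊((i:ℝ)+1)*α⌋ ≤ ⌊(n:ℝ)*α⌋ + 1 := by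
    intro n
    have h1 := Int.le_floor_add ((n:ℝ)*α) (((i:ℝ)+1)*α)
    have h2 := Int.le_floor_add_floor ((n:ℝ)*α) (((i:ℝ)+1)*α)
    rw [← add_mul] at h1 h2
    constructor <;> omega
  have hpos : (⌊((i:ℝ)+1)*α⌋ : ℝ) < ((i:ℝ)+1)*α := by
    refine lt_of_le_of_ne (Int.floor_le _) fun h => ?_
    have : Irrational (((i+1 : ℕ) : ℝ) * α) := hirr.natCast_mul (by omega)
    push_cast at this
    exact this ⟨(⌊((i:ℝ)+1)*α⌋ : ℚ), by rw [← h]; simp⟩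
  have hlt := Int.lt_floor_add_one (((i:ℝ)+1)*α)
  constructor
  · refine aux_lt _ _ (fun n => ⌊(n:ℝ)*α⌋) (fun n => ⌊((n : ℝ) + (i+1)) * α⌋ - ⌊((i:ℝ)+1)*α⌋)
      (by simp) ?_ hv (fun n => (hle n).1) ?_
    · intro n
      cases n with
      | zero => simp [pre, hα0]
      | succ k =>
        simp only [pre]
        rw [hc]
        push_cast
        ring_nf
    · by_contra! h
      have key : ∀ k : ℕ, ⌊((k:ℝ) * (i+1)) * α⌋ = k * ⌊((i:ℝ)+1)*α⌋ := by
        intro k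
        induction k with
        | zero => simp
        | succ k ih =>
          have := h (k*(i+1))
          push_cast at this ⊢
          rw [ih] at this
          rw [add_one_mul (k:ℝ)]
          linarith
      obtain ⟨k, hk⟩ := exists_nat_gt (1 / (((i:ℝ)+1)*α - ⌊((i:ℝ)+1)*α⌋))
      rw [div_lt_iff₀ (by linarith)] at hk
      have := Int.lt_floor_add_one (((k:ℝ) * (i+1)) * α)
      rw [key] at this
      push_cast at this
      linarith
  · refine aux_lt _ _ (fun n => ⌊((n : ℝ) + (i+1)) * α⌋ - ⌊((i:ℝ)+1)*α⌋)
      (fun n => if n = 0 then 0 else ⌊(n:ℝ)*α⌋ + 1)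
      (by simp) hv ?_ ?_ ?_
    · intro n
      cases n with
      | zero => simp [pre, hα0]
      | succ k =>
        simp only [pre]
        rw [hc]
        simp
        ring_nf
    · intro n
      cases n with
      | zero => simp
      | succ k => simpa using (hle (k+1)).2
    · by_contra! h
      have key : ∀ k : ℕ, ⌊(((k:ℝ)+1) * (i+1)) * α⌋ = (k+1) * ⌊((i:ℝ)+1)*α⌋ + k := by
        intro k
        induction k with
        | zero => simp
        | succ k ih =>
          have := h ((k+1)*(i+1))
          rw [if_neg (by positivity)] at this
          push_cast at this ⊢
          rw [ih] at this
          rw [add_one_mul ((k:ℝ)+1)]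
          linarith
      obtain ⟨k, hk⟩ := exists_nat_gt (1 / (⌊((i:ℝ)+1)*α⌋ + 1 - ((i:ℝ)+1)*α))
      rw [div_lt_iff₀ (by linarith)] at hk
      have := Int.floor_le ((((k:ℝ)+1) * (i+1)) * α)
      rw [key] at this
      push_cast at this
      linarith

/-- For the characteristic Sturmian sequence `c` of irrational slope `α ∈ (0,1)`:
`0·c < Tⁱ(0·c)` and `Tⁱ(1·c) < 1·c` for all `i ≥ 1`, and in particular
`0·c < Tⁱ(c) < 1·c` for all `i ≥ 0`. -/
theorem stmt9 (α : ℝ) (hα : α ∈ Set.Ioo (0 : ℝ) 1) (hirr : Irrational α)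
    (c : ℕ → Fin 2) (hc : IsCharSturmian α c) :
    (∀ i ≥ 1, SeqLt (pre 0 c) (shiftMap^[i] (pre 0 c)) ∧
       SeqLt (shiftMap^[i] (pre 1 c)) (pre 1 c)) ∧
    (∀ i : ℕ, SeqLt (pre 0 c) (shiftMap^[i] c) ∧ SeqLt (shiftMap^[i] c) (pre 1 c)) := by
  have hm := aux_main α hirr c hc hα
  refine ⟨fun i hi => ?_, hm⟩
  obtain ⟨k, rfl⟩ : ∃ k, i = k + 1 := ⟨i - 1, by omega⟩
  have e : ∀ x : Fin 2, shiftMap^[k+1] (pre x c) = shiftMap^[k] c := by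
    intro x
    rw [Function.iterate_succ_apply]
    rfl
  rw [e, e]
  exact hm k
end

section
/- Let α > 0 be irrational and let ρ, ρ′ be real numbers with 0 ≤ ρ < 1 and 0 ≤ ρ′ < 1. Define the binary sequences s_{α,ρ} and s_{α,ρ′} by s_{α,ρ}(n) = 0 if ⌊(n+1)α + ρ⌋ − ⌊nα + ρ⌋ = ⌊α⌋ and s_{α,ρ}(n) = 1 otherwise (and similarly for ρ′). Then s_{α,ρ} < s_{α,ρ′} in the lexicographic order if and only if ρ < ρ′. -/
theorem aux_dense (α ρ ρ' : ℝ) (hirr : Irrational α) (h : ρ < ρ') :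
    ∃ n : ℕ, ⌊(n : ℝ) * α + ρ⌋ < ⌊(n : ℝ) * α + ρ'⌋ := by
  haveI : Fact ((0:ℝ) < 1) := ⟨one_pos⟩
  have hd : DenseRange (fun n : ℕ => n • ((-α : ℝ) : AddCircle (1:ℝ))) := by
    rw [← denseRange_zsmul_iff_nsmul, AddCircle.denseRange_zsmul_coe_iff]
    simpa using hirr
  have ho : IsOpen ((fun x : ℝ => (x : AddCircle (1:ℝ))) '' Set.Ioo ρ ρ') :=
    QuotientAddGroup.isOpenMap_coe _ isOpen_Ioo
  obtain ⟨n, x, hx, hxn⟩ := hd.exists_mem_open ho ((Set.nonempty_Ioo.2 h).image _)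
  have h2 : ((x + n * α : ℝ) : AddCircle (1:ℝ)) = 0 := by
    simp only at hxn
    rw [AddCircle.coe_add, hxn, ← AddCircle.coe_nsmul, ← AddCircle.coe_add]
    simp
  obtain ⟨m, hm⟩ := (AddCircle.coe_eq_zero_iff (1:ℝ)).1 h2
  simp only [zsmul_eq_mul, mul_one] at hm
  refine ⟨n, ?_⟩
  have h3 : ⌊(n : ℝ) * α + ρ⌋ < m := Int.floor_lt.2 (by linarith [hx.1])
  have h4 : m ≤ ⌊(n : ℝ) * α + ρ'⌋ := Int.le_floor.2 (by linarith [hx.2])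
  omega

theorem aux_step (x α : ℝ) : ⌊x + α⌋ - ⌊x⌋ = ⌊α⌋ ∨ ⌊x + α⌋ - ⌊x⌋ = ⌊α⌋ + 1 := by
  have h1 := Int.le_floor_add x α
  have h2 := Int.le_floor_add_floor x α
  omega

theorem aux_val (α ρ : ℝ) (s : ℕ → Fin 2)
    (hs : ∀ n : ℕ,
      s n = if ⌊((n : ℝ) + 1) * α + ρ⌋ - ⌊(n : ℝ) * α + ρ⌋ = ⌊α⌋ then 0 else 1) (n : ℕ) :
    ⌊((n + 1 : ℕ) : ℝ) * α + ρ⌋ = ⌊(n : ℝ) * α + ρ⌋ + ⌊α⌋ + ((s n : ℕ) : ℤ) := by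
  have h := aux_step ((n : ℝ) * α + ρ) α
  have e : (n : ℝ) * α + ρ + α = ((n : ℝ) + 1) * α + ρ := by ring
  rw [e] at h
  have h1 := hs n
  push_cast
  split_ifs at h1 with h2
  · rw [h1]; simp; omega
  · rw [h1]; simp; omega

/-- For irrational `α > 0` and intercepts `ρ, ρ′ ∈ [0,1)`, the mechanical
sequences satisfy `s_{α,ρ} < s_{α,ρ′}` lexicographically iff `ρ < ρ′`. -/
theorem stmt10 (α ρ ρ' : ℝ) (hα : 0 < α) (hirr : Irrational α)
    (hρ0 : 0 ≤ ρ) (hρ1 : ρ < 1) (hρ'0 : 0 ≤ ρ') (hρ'1 : ρ' < 1)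
    (s s' : ℕ → Fin 2)
    (hs : ∀ n : ℕ,
      s n = if ⌊((n : ℝ) + 1) * α + ρ⌋ - ⌊(n : ℝ) * α + ρ⌋ = ⌊α⌋ then 0 else 1)
    (hs' : ∀ n : ℕ,
      s' n = if ⌊((n : ℝ) + 1) * α + ρ'⌋ - ⌊(n : ℝ) * α + ρ'⌋ = ⌊α⌋ then 0 else 1) :
    SeqLt s s' ↔ ρ < ρ' := by
  have v := aux_val α ρ s hs
  have v' := aux_val α ρ' s' hs'
  have z : ⌊((0 : ℕ) : ℝ) * α + ρ⌋ = 0 := by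
    simp [Int.floor_eq_zero_iff, hρ0, hρ1]
  have z' : ⌊((0 : ℕ) : ℝ) * α + ρ'⌋ = 0 := by
    simp [Int.floor_eq_zero_iff, hρ'0, hρ'1]
  constructor
  · rintro ⟨i, hi, hlt⟩
    by_contra hle
    push Not at hle
    have key : ∀ j ≤ i, ⌊(j : ℝ) * α + ρ⌋ = ⌊(j : ℝ) * α + ρ'⌋ := by
      intro j
      induction j with
      | zero => intro _; rw [z, z']
      | succ k ih =>
        intro hk
        rw [v, v', ih (by omega), hi k (by omega)]
    have h1 := v i
    have h2 := v' i
    have h3 := key i le_rfl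
    have h4 : ⌊((i + 1 : ℕ) : ℝ) * α + ρ'⌋ ≤ ⌊((i + 1 : ℕ) : ℝ) * α + ρ⌋ :=
      Int.floor_mono (by linarith)
    have h5 : (s i : ℕ) < (s' i : ℕ) := hlt
    omega
  · intro h
    classical
    have hex := aux_dense α ρ ρ' hirr h
    have hspec := Nat.find_spec hex
    have hmin : ∀ j < Nat.find hex, ⌊(j : ℝ) * α + ρ⌋ = ⌊(j : ℝ) * α + ρ'⌋ := by
      intro j hj
      have h1 := Nat.find_min hex hj
      have h2 : ⌊(j : ℝ) * α + ρ⌋ ≤ ⌊(j : ℝ) * α + ρ'⌋ := Int.floor_mono (by linarith)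
      omega
    generalize Nat.find hex = N at hspec hmin
    cases N with
    | zero => rw [z, z'] at hspec; omega
    | succ i =>
      refine ⟨i, ?_, ?_⟩
      · intro j hj
        have h1 := v j
        have h2 := v' j
        have h3 := hmin j (by omega)
        have h4 := hmin (j + 1) (by omega)
        apply Fin.ext
        omega
      · have h1 := v i
        have h2 := v' i
        have h3 := hmin i (by omega)
        change (s i : ℕ) < (s' i : ℕ)
        omega
end

section
/- A binary sequence s satisfies the block condition — i.e., for every finite binary word w, at least one of the words 0w0 and 1w1 is not a factor of s — if and only if there exists a binary sequence u such that 0·u ≤ T^i(s) ≤ 1·u for all i ≥ 0 (lexicographic order). -/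
theorem aux_shift {A : Type*} (s : ℕ → A) (i n : ℕ) : (shiftMap^[i] s) n = s (i + n) := by
  induction i generalizing s n with
  | zero => simp
  | succ k ih =>
    rw [Function.iterate_succ_apply, ih]
    simp only [shiftMap]
    congr 1
    omega

theorem aux_window {A : Type*} (s : ℕ → A) (i n : ℕ) :
    window s i (n + 2) = s i :: (window s (i + 1) n ++ [s (i + 1 + n)]) := by
  unfold window
  rw [List.range_succ, List.range_succ_eq_map]
  simp [Function.comp_def, Nat.add_comm]
  exact ⟨fun a _ => by congr 1; omega, by congr 1; omega⟩

theorem aux_window_eq {A : Type*} (s : ℕ → A) (i j n : ℕ) :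
    window s i n = window s j n ↔ ∀ k < n, s (i + k) = s (j + k) := by
  unfold window
  simp

theorem aux_factor {A : Type*} (s : ℕ → A) (x y : A) (w : List A) :
    IsFactor s (x :: (w ++ [y])) ↔
      ∃ i, s i = x ∧ window s (i + 1) w.length = w ∧ s (i + 1 + w.length) = y := by
  unfold IsFactor
  apply exists_congr
  intro i
  have : (x :: (w ++ [y])).length = w.length + 2 := by simp
  rw [this, aux_window, List.cons.injEq, List.append_singleton_inj]
  constructor
  · rintro ⟨h1, h2, h3⟩
    exact ⟨h1.symm, h2.symm, h3.symm⟩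
  · rintro ⟨h1, h2, h3⟩
    exact ⟨h1.symm, h2.symm, h3.symm⟩

theorem aux_block (s : ℕ → Fin 2) :
    (∀ w : List (Fin 2),
        ¬ (IsFactor s (0 :: (w ++ [0])) ∧ IsFactor s (1 :: (w ++ [1])))) ↔
    ∀ i j n, s i = 0 → s j = 1 → (∀ k < n, s (i + 1 + k) = s (j + 1 + k)) →
      s (i + 1 + n) = 0 → s (j + 1 + n) = 1 → False := by
  simp only [aux_factor]
  constructor
  · intro h i j n hi hj hk h0 h1
    have hl : (window s (i + 1) n).length = n := by simp [window]
    refine h (window s (i + 1) n) ⟨⟨i, hi, ?_, ?_⟩, ⟨j, hj, ?_, ?_⟩⟩ <;> rw [hl]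
    · exact h0
    · exact ((aux_window_eq s _ _ n).2 hk).symm
    · exact h1
  · rintro h w ⟨⟨i, hi, hw, h0⟩, ⟨j, hj, hw', h1⟩⟩
    exact h i j _ hi hj ((aux_window_eq s _ _ _).1 (hw.trans hw'.symm)) h0 h1

theorem aux_le (a b : ℕ → Fin 2) :
    SeqLe a b ↔ ∀ n, (∀ k < n, a k = b k) → a n = 1 → b n = 0 → False := by
  constructor
  · rintro (h | ⟨i, hi, hlt⟩) n hn h1 h0
    · have := h n
      rw [h1, h0] at this
      exact absurd this (by decide)
    · rcases lt_trichotomy n i with hl | rfl | hl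
      · have := hi n hl
        rw [h1, h0] at this
        exact absurd this (by decide)
      · rw [h1, h0] at hlt
        exact absurd hlt (by decide)
      · rw [hn i hl] at hlt
        exact lt_irrefl _ hlt
  · intro h
    by_cases hall : ∀ n, a n = b n
    · exact Or.inl hall
    · right
      push Not at hall
      classical
      have hmin : ∀ k < Nat.find hall, a k = b k := fun k hk => by
        simpa using Nat.find_min hall hk
      refine ⟨Nat.find hall, hmin, ?_⟩
      have h1 := h _ hmin
      have h2 := Nat.find_spec hall
      generalize a (Nat.find hall) = x at *
      generalize b (Nat.find hall) = y at *
      revert h1 h2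
      revert x y
      decide

theorem aux_sup (B : Set (ℕ → Fin 2)) : ∃ u : ℕ → Fin 2,
    ∀ n, u n = 1 ↔ ∃ b ∈ B, (∀ k < n, b k = u k) ∧ b n = 1 := by
  classical
  let F : ∀ n : ℕ, (∀ m, m < n → Fin 2) → Fin 2 := fun n f =>
    if ∃ b ∈ B, (∀ k, ∀ h : k < n, b k = f k h) ∧ b n = 1 then 1 else 0
  refine ⟨Nat.lt_wfRel.wf.fix F, fun n => ?_⟩
  rw [WellFounded.fix_eq]
  simp only [F]
  split_ifs with h
  · exact ⟨fun _ => h, fun _ => rfl⟩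
  · exact ⟨fun h' => absurd h' (by decide), fun h' => absurd h' h⟩

theorem aux_fin (x : Fin 2) : x = 0 ∨ x = 1 := by
  revert x
  decide

theorem stmt11 (s : ℕ → Fin 2) :
    (∀ w : List (Fin 2),
        ¬ (IsFactor s (0 :: (w ++ [0])) ∧ IsFactor s (1 :: (w ++ [1])))) ↔
    (∃ u : ℕ → Fin 2, ∀ i : ℕ,
        SeqLe (pre 0 u) (shiftMap^[i] s) ∧ SeqLe (shiftMap^[i] s) (pre 1 u)) := by
  rw [aux_block]
  simp only [aux_le, aux_shift]
  constructor
  · intro h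
    obtain ⟨u, hu⟩ := aux_sup {b | ∃ j, s j = 1 ∧ ∀ n, b n = s (j + 1 + n)}
    refine ⟨u, fun i => ⟨?_, ?_⟩⟩
    · rintro (_ | n) hk h1 h0
      · exact absurd h1 (by simp [pre])
      · obtain ⟨b, ⟨j, hj, hb⟩, hbk, hb1⟩ := (hu n).1 h1
        refine h i j n (hk 0 (by omega)).symm hj (fun k hkn => ?_) ?_ ?_
        · rw [← hb, hbk k hkn]
          have := hk (k + 1) (by omega)
          rw [show i + 1 + k = i + (k + 1) by omega, ← this]
          rfl
        · rw [← h0]; congr 1; omega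
        · rw [← hb, hb1]
    · rintro (_ | n) hk h1 h0
      · exact absurd h0 (by simp [pre])
      · have h0' : u n = 0 := h0
        have : u n = 1 := (hu n).2 ⟨fun n => s (i + 1 + n), ⟨i, hk 0 (by omega), fun _ => rfl⟩,
          fun k hkn => by
            have := hk (k + 1) (by omega)
            show s (i + 1 + k) = u k
            rw [show i + 1 + k = i + (k + 1) by omega, this]
            rfl, by
            show s (i + 1 + n) = 1
            rw [← h1]; congr 1; omega⟩
        rw [h0'] at this
        exact absurd this (by decide)
  · rintro ⟨u, hu⟩ i j n hi hj hk h0 h1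
    have e : ∀ i k, s (i + (k + 1)) = s (i + 1 + k) := fun i k => by congr 1; omega
    -- first difference between u and the common block
    have key : ∀ k ≤ n, (∀ m < k, u m = s (i + 1 + m)) := by
      intro k
      induction k with
      | zero => intro _ m hm; omega
      | succ k ih =>
        intro hkn m hm
        have ih' := ih (by omega)
        rcases Nat.lt_succ_iff_lt_or_eq.1 hm with hm | rfl
        · exact ih' m hm
        · have A := (hu i).1 (m + 1) (by
            rintro (_ | q) hq
            · exact hi.symm
            · rw [e]; exact ih' q (by omega))
          have B := (hu j).2 (m + 1) (by
            rintro (_ | q) hq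
            · exact hj
            · rw [e, ← hk q (by omega)]; exact (ih' q (by omega)).symm)
          rw [e] at A B
          rw [← hk m (by omega)] at B
          simp only [pre] at A B
          rcases aux_fin (u m) with h | h <;> rcases aux_fin (s (i + 1 + m)) with h' | h'
          · rw [h, h']
          · exact (B h' h).elim
          · exact (A h h').elim
          · rw [h, h']
    have key' := key n le_rfl
    have A := (hu i).1 (n + 1) (by
      rintro (_ | q) hq
      · exact hi.symm
      · rw [e]; exact key' q (by omega))
    have B := (hu j).2 (n + 1) (by
      rintro (_ | q) hq
      · exact hj
      · rw [e, ← hk q (by omega)]; exact (key' q (by omega)).symm)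
    rw [e] at A B
    rcases aux_fin (u n) with h | h
    · exact B h1 h
    · exact A h h0
end

section
/- Let d ≥ 2 and let t : ℕ → A be a recurrent sequence over the finite alphabet A = {0,1,…,d−1}. Then t is episturmian (its set of factors is closed under reversal and t admits at most one left special factor of each length) if and only if there exists a sequence u : ℕ → A such that for every permutation σ of A and every i ≥ 0, the sequence σ∘(a·u) is lexicographically ≤ the sequence σ∘(T^i(t)), where a = σ⁻¹(0) and the lexicographic order is taken with respect to the natural order 0 < 1 < ⋯ < d−1 (this expresses: a·u ≤ T^i(t) for every total order on A whose least element is a, over all acceptable pairs (a,<)). Moreover, if t is aperiodic, then u has the same set of factors as t and every left special factor of u is a prefix of u (u is the unique epistandard word with the same set of factors as t). -/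
namespace Epi

variable {A : Type*}

theorem len_window (s : ℕ → A) (i k : ℕ) : (window s i k).length = k := by simp [window]

theorem window_succ (s : ℕ → A) (i k : ℕ) :
    window s i (k+1) = window s i k ++ [s (i+k)] := by
  simp [window, List.range_succ]

theorem window_add (s : ℕ → A) (i k m : ℕ) :
    window s i (k+m) = window s i k ++ window s (i+k) m := by
  induction m with
  | zero => simp [window]
  | succ m ih => rw [← Nat.add_assoc, window_succ, ih, window_succ]; simp [Nat.add_assoc]

theorem window_cons (s : ℕ → A) (i k : ℕ) :
    window s i (k+1) = s i :: window s (i+1) k := by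
  rw [Nat.add_comm k 1, window_add]; simp [window]

theorem window_eq (s s' : ℕ → A) (i i' k : ℕ) :
    window s i k = window s' i' k ↔ ∀ j < k, s (i+j) = s' (i'+j) := by
  simp [window]

theorem fac_window (s : ℕ → A) (i k : ℕ) : IsFactor s (window s i k) :=
  ⟨i, by rw [len_window]⟩

theorem fac_iff (s : ℕ → A) (l : List A) : IsFactor s l ↔ ∃ i k, l = window s i k := by
  constructor
  · rintro ⟨i, h⟩; exact ⟨i, _, h⟩
  · rintro ⟨i, k, rfl⟩; exact fac_window s i k

theorem fac_append {s : ℕ → A} {l m : List A} (h : IsFactor s (l ++ m)) :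
    IsFactor s l ∧ IsFactor s m := by
  obtain ⟨i, h⟩ := h
  rw [List.length_append, window_add] at h
  obtain ⟨h1, h2⟩ := List.append_inj h (by rw [len_window])
  exact ⟨⟨i, h1⟩, ⟨_, h2⟩⟩

theorem fac_cons {s : ℕ → A} {x : A} {l : List A} (h : IsFactor s (x :: l)) : IsFactor s l :=
  (fac_append (l := [x]) (m := l) h).2

theorem fac_right {s : ℕ → A} {l : List A} (h : IsFactor s l) : ∃ x, IsFactor s (l ++ [x]) := by
  obtain ⟨i, h⟩ := h
  refine ⟨s (i + l.length), i, ?_⟩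
  rw [List.length_append, List.length_singleton, window_succ, ← h]

def Rec (t : ℕ → A) : Prop :=
  ∀ l : List A, IsFactor t l → ∀ N, ∃ i ≥ N, l = window t i l.length

theorem fac_left {t : ℕ → A} (hr : Rec t) {l : List A} (h : IsFactor t l) :
    ∃ x, IsFactor t (x :: l) := by
  obtain ⟨i, hi, h⟩ := hr l h 1
  obtain ⟨i, rfl⟩ := Nat.exists_eq_add_of_le' hi
  refine ⟨t i, i, ?_⟩
  rw [List.length_cons, window_cons, ← h]

theorem ls_append {t : ℕ → A} {l m : List A} (h : LeftSpecial t (l ++ m)) : LeftSpecial t l := by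
  obtain ⟨x, y, hxy, h1, h2⟩ := h
  exact ⟨x, y, hxy, (fac_append (l := x :: l) (m := m) h1).1,
    (fac_append (l := y :: l) (m := m) h2).1⟩

theorem ls_take {t : ℕ → A} {l : List A} (k : ℕ) (h : LeftSpecial t l) :
    LeftSpecial t (l.take k) := by
  apply ls_append (m := l.drop k); rwa [List.take_append_drop]

theorem ls_fac {t : ℕ → A} {l : List A} (h : LeftSpecial t l) : IsFactor t l := by
  obtain ⟨x, y, hxy, h1, h2⟩ := h
  exact fac_cons h1

/-- the combinatorial condition at length `n` -/
def C (t u : ℕ → A) (n : ℕ) : Prop :=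
  ∀ a x, IsFactor t (a :: (window u 0 n ++ [x])) → a = u n ∨ x = u n

theorem C_iff (t u : ℕ → A) (n : ℕ) : C t u n ↔
    ∀ i, (∀ j < n, t (i+1+j) = u j) → t i = u n ∨ t (i+1+n) = u n := by
  constructor
  · intro h i hi
    apply h
    refine ⟨i, ?_⟩
    have : window t (i+1) n = window u 0 n := by rw [window_eq]; simpa using hi
    simp only [List.length_cons, List.length_append, len_window, List.length_nil]
    rw [window_cons, window_succ, this]
  · rintro h a x ⟨i, hi⟩
    simp only [List.length_cons, List.length_append, len_window, List.length_nil] at hi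
    rw [window_cons, window_succ] at hi
    obtain ⟨rfl, hi2⟩ := List.cons.inj hi
    obtain ⟨h1, h2⟩ := List.append_inj' hi2 rfl
    rw [eq_comm, window_eq] at h1
    obtain ⟨rfl, -⟩ := List.cons.inj h2
    apply h
    simpa using h1

theorem ls_prefix {t u : ℕ → A} (hC : ∀ n, C t u n) (v : List A) (h : LeftSpecial t v) :
    v = window u 0 v.length := by
  induction v using List.reverseRecOn with
  | nil => simp [window]
  | append_singleton v x ih =>
    have hv := ih (ls_append h)
    obtain ⟨a, b, hab, h1, h2⟩ := h
    rw [List.length_append, List.length_singleton, window_succ, ← hv]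
    rw [hv] at h1 h2
    rcases hC _ _ _ h1 with h1 | h1
    · rcases hC _ _ _ h2 with h2 | h2
      · exact absurd (h1.trans h2.symm) hab
      · simp [h2]
    · simp [h1]

theorem reversal {t u : ℕ → A} (hr : Rec t) (hC : ∀ n, C t u n) :
    ∀ n, ∀ l : List A, l.length = n → IsFactor t l → IsFactor t l.reverse := by
  intro n
  induction n using Nat.strong_induction_on with
  | _ n IH =>
  intro l hl hf
  match l, hl, hf with
  | [], _, hf => simpa using hf
  | a :: l', hl, hf =>
  rcases List.eq_nil_or_concat l' with rfl | ⟨g, x, rfl⟩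
  · simpa using hf
  simp only [List.concat_eq_append] at *
  simp only [List.length_cons, List.length_append, List.length_nil] at hl
  have h1 : IsFactor t (g.reverse ++ [a]) := by
    have := IH (g.length+1) (by omega) (a :: g) (by simp)
      (fac_append (l := a :: g) (m := [x]) hf).1
    simpa using this
  have h2 : IsFactor t (x :: g.reverse) := by
    have := IH (g.length+1) (by omega) (g ++ [x]) (by simp) (fac_cons hf)
    simpa using this
  obtain ⟨z, hz⟩ := fac_right h2
  obtain ⟨z', hz'⟩ := fac_left hr h1
  have goal : (a :: (g ++ [x])).reverse = x :: (g.reverse ++ [a]) := by simp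
  rw [goal]
  by_cases hza : z = a
  · subst hza; exact hz
  by_cases hzx : z' = x
  · subst hzx; exact hz'
  have hl1 : LeftSpecial t g.reverse :=
    ⟨x, z', fun h => hzx h.symm, h2, (fac_append (l := z' :: g.reverse) hz').1⟩
  have hl2 : LeftSpecial t g := by
    refine ⟨z, a, hza, ?_, (fac_append (l := a :: g) (m := [x]) hf).1⟩
    have := IH (g.length+1) (by omega) (g.reverse ++ [z]) (by simp) (fac_cons hz)
    simpa using this
  have e1 := ls_prefix hC _ hl1
  have e2 := ls_prefix hC _ hl2
  rw [List.length_reverse, ← e2] at e1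
  rw [e1] at hz hz' ⊢
  rw [e2] at hf hz hz' ⊢
  set w := window u 0 g.length
  have c1 := hC _ _ _ hf
  have c2 := hC _ _ _ hz
  have c3 := hC _ _ _ hz'
  rcases c1 with c1 | c1
  · rcases c2 with c2 | c2
    · rw [c2, ← c1]; rw [c2, ← c1] at hf; exact hf
    · exact absurd (c2.trans c1.symm) hza
  · rcases c3 with c3 | c3
    · exact absurd (c3.trans c1.symm) hzx
    · rw [c1, ← c3]; rw [c1, ← c3] at hf; exact hf

theorem rev_window (u : ℕ → A) (n : ℕ) (h : (window u 0 n).reverse = window u 0 n) :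
    ∀ j < n, u j = u (n-1-j) := by
  intro j hj
  have h2 := congrArg (fun l => l[j]?) h
  simp [window, hj] at h2
  exact h2.symm

/-- return words are palindromic -/
theorem ret {t u : ℕ → A} (n : ℕ) (hw : ∀ j < n, u j = u (n-1-j))
    (IH : ∀ m < n, C t u m)
    (pal : ∀ m < n, ∀ z z', z ≠ z' → IsFactor t (window u 0 m ++ [z]) →
      IsFactor t (window u 0 m ++ [z']) → ∀ j < m, u j = u (m-1-j))
    (i j : ℕ) (hij : i < j) (hi : ∀ k < n, t (i+k) = u k) (hj : ∀ k < n, t (j+k) = u k)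
    (hno : ∀ j', i < j' → j' < j → ¬ ∀ k < n, t (j'+k) = u k) :
    t (j-1) = t (i+n) := by
  rcases Nat.lt_trichotomy j (i+n+1) with h | h | h
  · have e1 := hj (i+n-j) (by omega)
    have e2 := hi (j-1-i) (by omega)
    rw [hw _ (by omega)] at e2
    rw [show j + (i+n-j) = i+n by omega] at e1
    rw [show i + (j-1-i) = j-1 by omega, show n-1-(j-1-i) = i+n-j by omega] at e2
    rw [e1, e2]
  · subst h; rfl
  · exfalso
    have key : ∀ r m, m ≤ n → n - m = r → t (i+n-m) = t (i+n) →
        (∀ k < m, t (i+n+1-m+k) = u k) → False := by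
      intro r
      induction r using Nat.strong_induction_on with
      | _ r IHr =>
      intro m hm hr hx hag
      have hnot := hno (i+n+1-m) (by omega) (by omega)
      classical
      have hex : ∃ k, k < n ∧ t (i+n+1-m+k) ≠ u k := by
        push Not at hnot
        obtain ⟨k, h1, h2⟩ := hnot
        exact ⟨k, h1, h2⟩
      obtain ⟨l, ⟨hln, hl⟩, hmin⟩ : ∃ l, (l < n ∧ t (i+n+1-m+l) ≠ u l) ∧
          ∀ k < l, t (i+n+1-m+k) = u k := by
        refine ⟨Nat.find hex, Nat.find_spec hex, fun k hk => ?_⟩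
        have := Nat.find_min hex hk
        by_contra hne
        exact this ⟨by have := (Nat.find_spec hex).1; omega, hne⟩
      have hml : m ≤ l := by
        by_contra hlt
        exact hl (hag l (by omega))
      have hc := (C_iff t u l).1 (IH l hln) (i+n-m)
        (by intro j hj; rw [show i+n-m+1+j = i+n+1-m+j by omega]; exact hmin j hj)
      rw [show i+n-m+1+l = i+n+1-m+l by omega] at hc
      have hul : t (i+n-m) = u l := hc.resolve_right hl
      have hpal := pal l hln _ _ hl (by
          have : window u 0 l = window t (i+n+1-m) l := by
            rw [eq_comm, window_eq]; simpa using hmin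
          rw [this, ← window_succ]; exact fac_window _ _ _)
        (by
          have : window u 0 l ++ [u l] = window t i (l+1) := by
            have h0 := window_succ u 0 l
            rw [Nat.zero_add] at h0
            rw [← h0, eq_comm, window_eq]
            intro k hk; rw [Nat.zero_add]; exact hi k (by omega)
          rw [this]; exact fac_window _ _ _)
      refine IHr (n-(l+1)) (by omega) (l+1) (by omega) rfl ?_ ?_
      · have := hi (n-1-l) (by omega)
        rw [show i+n-(l+1) = i+(n-1-l) by omega, this, ← hw l hln, ← hul, hx]
      · intro k hk
        rcases Nat.lt_or_ge k l with hkl | hkl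
        · rw [show i+n+1-(l+1)+k = i+(n-l+k) by omega, hi _ (by omega), hw _ (by omega),
            show n-1-(n-l+k) = l-1-k by omega, ← hpal k hkl]
        · obtain rfl : k = l := by omega
          rw [show i+n+1-(k+1)+k = i+n by omega, ← hx, hul]
    exact key n 0 (by omega) rfl (by simp) (by simp)

theorem dyn {t u : ℕ → A} (n : ℕ) (a x : A)
    (hret : ∀ i j : ℕ, i < j → (∀ k < n, t (i+k) = u k) → (∀ k < n, t (j+k) = u k) →
      (∀ j', i < j' → j' < j → ¬ ∀ k < n, t (j'+k) = u k) → t (j-1) = t (i+n))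
    (ha : ∀ z, IsFactor t (a :: (window u 0 n ++ [z])) → z = x)
    (hx : ∀ z, IsFactor t (x :: (window u 0 n ++ [z])) → z = a)
    (i : ℕ) (hi : ∀ k < n, t (i+k) = u k) (hix : t (i+n) = x) :
    ∀ j, i ≤ j → (∀ k < n, t (j+k) = u k) → t (j+n) = a ∨ t (j+n) = x := by
  intro j
  induction j using Nat.strong_induction_on with
  | _ j IH =>
  intro hij hj
  rcases Nat.eq_or_lt_of_le hij with rfl | hij
  · exact Or.inr hix
  classical
  let P : ℕ → Prop := fun m => i ≤ m ∧ ∀ k < n, t (m+k) = u k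
  have hP : P i := ⟨le_rfl, hi⟩
  have hg : P (Nat.findGreatest P (j-1)) := Nat.findGreatest_spec (m := i) (by omega) hP
  have hle : Nat.findGreatest P (j-1) ≤ j-1 := Nat.findGreatest_le _
  have hgt : ∀ k, Nat.findGreatest P (j-1) < k → k ≤ j-1 → ¬ P k :=
    fun k h1 h2 => Nat.findGreatest_is_greatest h1 h2
  generalize Nat.findGreatest P (j-1) = m at hg hle hgt
  have hr := hret m j (by omega) hg.2 hj (fun j' h1 h2 h3 =>
    hgt j' h1 (by omega) ⟨by have := hg.1; omega, h3⟩)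
  have hf : IsFactor t (t (j-1) :: (window u 0 n ++ [t (j+n)])) := by
    have e : window t (j-1) (n+1+1) = t (j-1) :: (window u 0 n ++ [t (j+n)]) := by
      rw [window_cons, window_succ, show j-1+1 = j by omega]
      congr 2
      rw [window_eq]; simpa using hj
    rw [← e]; exact fac_window _ _ _
  rw [hr] at hf
  rcases IH m (by omega) hg.1 hg.2 with h | h
  · rw [h] at hf; exact Or.inr (ha _ hf)
  · rw [h] at hf; exact Or.inl (hx _ hf)

theorem fac_snoc_pos {t u : ℕ → A} (n : ℕ) (x : A) (hr : Rec t)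
    (h : IsFactor t (window u 0 n ++ [x])) (N : ℕ) :
    ∃ i ≥ N, (∀ k < n, t (i+k) = u k) ∧ t (i+n) = x := by
  obtain ⟨i, hi, h⟩ := hr _ h N
  simp only [List.length_append, len_window, List.length_singleton] at h
  rw [window_succ] at h
  obtain ⟨h1, h2⟩ := List.append_inj' h rfl
  rw [eq_comm, window_eq] at h1
  refine ⟨i, hi, by simpa using h1, by simpa using h2.symm⟩

theorem C_of_epi {t u : ℕ → A} (hr : Rec t)
    (hrev : ∀ l : List A, IsFactor t l → IsFactor t l.reverse)
    (huniq : ∀ w w' : List A, w.length = w'.length →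
          LeftSpecial t w → LeftSpecial t w' → w = w')
    (H1 : ∀ n, IsFactor t (window u 0 n))
    (H2 : ∀ w, LeftSpecial t w → LeftSpecial t (window u 0 w.length)) (n : ℕ) :
    C t u n := by
  induction n using Nat.strong_induction_on with
  | _ n IH =>
  have pal0 : ∀ m, ∀ z z', z ≠ z' → IsFactor t (window u 0 m ++ [z]) →
      IsFactor t (window u 0 m ++ [z']) → (window u 0 m).reverse = window u 0 m := by
    intro m z z' hz h1 h2
    have h1 := hrev _ h1
    have h2 := hrev _ h2
    have hl : LeftSpecial t (window u 0 m).reverse := ⟨z, z', hz, by simpa using h1, by simpa using h2⟩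
    have := H2 _ hl
    rw [List.length_reverse, len_window] at this
    exact huniq _ _ (by simp) hl this
  intro a x hf
  by_contra hcon
  push Not at hcon
  obtain ⟨hay, hxy⟩ := hcon
  have hy : IsFactor t (window u 0 n ++ [u n]) := by
    have := H1 (n+1)
    rwa [window_succ, Nat.zero_add] at this
  have hx := fac_cons hf
  have hp := pal0 n _ _ hxy hx hy
  have hnls : ∀ z, z ≠ u n → ¬ LeftSpecial t (window u 0 n ++ [z]) := by
    intro z hz hl
    have h2 := H2 _ hl
    have := huniq _ _ (by simp [len_window]) hl h2
    simp only [List.length_append, len_window, List.length_singleton] at this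
    rw [window_succ, Nat.zero_add] at this
    simp at this
    exact hz this
  have hsym : ∀ p q, IsFactor t (p :: (window u 0 n ++ [q])) →
      IsFactor t (q :: (window u 0 n ++ [p])) := by
    intro p q h
    have := hrev _ h
    simpa [hp] using this
  have hua : ∀ z, IsFactor t (a :: (window u 0 n ++ [z])) → z = x := by
    intro z hz
    by_contra hne
    exact hnls a hay ⟨z, x, hne, hsym _ _ hz, hsym _ _ hf⟩
  have hux : ∀ z, IsFactor t (x :: (window u 0 n ++ [z])) → z = a := by
    intro z hz
    by_contra hne
    exact hnls x hxy ⟨z, a, hne, hsym _ _ hz, hf⟩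
  obtain ⟨i, -, hi, hix⟩ := fac_snoc_pos n x hr hx 0
  obtain ⟨j, hj, hj1, hj2⟩ := fac_snoc_pos n (u n) hr hy i
  have := dyn n a x (ret n (rev_window u n hp) IH
    (fun m _ z z' h1 h2 h3 => rev_window u m (pal0 m z z' h1 h2 h3))) hua hux i hi hix j hj hj1
  rw [hj2] at this
  rcases this with h | h
  · exact hay h.symm
  · exact hxy h.symm

theorem exists_u {t : ℕ → A} 
    (huniq : ∀ w w' : List A, w.length = w'.length →
          LeftSpecial t w → LeftSpecial t w' → w = w') :
    ∃ u : ℕ → A, (∀ n, IsFactor t (window u 0 n)) ∧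
      (∀ w, LeftSpecial t w → LeftSpecial t (window u 0 w.length)) := by
  classical
  by_cases hall : ∀ m, ∃ w, w.length = m ∧ LeftSpecial t w
  · choose W hlen hW using hall
    let u : ℕ → A := fun n => (W (n+1))[n]'(by rw [hlen]; omega)
    have hu : ∀ n, window u 0 n = W n := by
      intro n
      induction n with
      | zero => 
        have := hlen 0
        rw [List.length_eq_zero_iff] at this
        simp [window, this]
      | succ n ih =>
        rw [window_succ, ih]
        have e : (W (n+1)).take n = W n :=
          huniq _ _ (by simp [hlen]) (ls_take _ (hW _)) (hW _)
        rw [← e, Nat.zero_add]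
        have h3 : n < (W (n+1)).length := by rw [hlen]; omega
        have : (W (n+1)).take n ++ [u n] = (W (n+1)).take (n+1) := by
          rw [List.take_add_one]; simp [u, h3]
        rw [this, List.take_of_length_le (by rw [hlen])]
    refine ⟨u, fun n => ?_, fun w _ => ?_⟩
    · rw [hu]; exact ls_fac (hW n)
    · rw [hu]; exact hW _
  · push Not at hall
    have hN := Nat.find_spec hall
    have hmin := fun m => Nat.find_min (H := hall) (m := m)
    generalize Nat.find hall = N at hN hmin
    have hbig : ∀ w, LeftSpecial t w → w.length < N := by
      intro w hw
      by_contra hlt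
      exact hN (w.take N) (by simp; omega) (ls_take _ hw)
    rcases N with _ | n
    · refine ⟨t, fun n => fac_window _ _ _, fun w hw => ?_⟩
      exact absurd (hbig w hw) (by omega)
    · have := hmin n (by omega)
      push Not at this
      obtain ⟨w, hwn, hw⟩ := this
      obtain ⟨i, hi⟩ := ls_fac hw
      have e : ∀ m, window (fun k => t (i+k)) 0 m = window t i m := by
        intro m; rw [window_eq]; simp
      refine ⟨fun k => t (i+k), fun m => ?_, fun v hv => ?_⟩
      · rw [e]; exact fac_window _ _ _
      · rw [e]
        have hb := hbig v hv
        obtain ⟨r, hr⟩ := Nat.exists_eq_add_of_le (show v.length ≤ w.length by omega)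
        rw [hr, window_add] at hi
        rw [hi] at hw
        exact ls_append hw

theorem exists_ls {t : ℕ → A} (hr : Rec t) (hap : ¬ UltimatelyPeriodic t) (n : ℕ) :
    ∃ w, w.length = n ∧ LeftSpecial t w := by
  by_contra hno
  push Not at hno
  have step : ∀ i j, window t (i+1) n = window t (j+1) n →
      t i = t j ∧ window t i n = window t j n := by
    intro i j h
    have h1 : t i = t j := by
      by_contra hne
      refine hno (window t (i+1) n) (len_window _ _ _) ⟨t i, t j, hne, ?_, ?_⟩
      · rw [← window_cons]; exact fac_window _ _ _
      · rw [h, ← window_cons]; exact fac_window _ _ _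
    refine ⟨h1, ?_⟩
    have h2 : window t i (n+1) = window t j (n+1) := by rw [window_cons, window_cons, h, h1]
    rw [window_succ, window_succ] at h2
    exact (List.append_inj' h2 rfl).1
  have steps : ∀ k i j, window t (i+k) n = window t (j+k) n → window t i n = window t j n := by
    intro k
    induction k with
    | zero => intro i j h; exact h
    | succ k ih =>
      intro i j h
      exact ih _ _ (step (i+k) (j+k) h).2
  obtain ⟨q, hq, hq1⟩ := hr _ (fac_window t 0 n) 1
  rw [len_window] at hq1
  refine hap ⟨0, q, hq, fun m _ => ?_⟩
  obtain ⟨p, hp, hp1⟩ := hr _ (fac_window t 0 n) (m+q+1)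
  rw [len_window] at hp1
  have h1 : window t (p-q) n = window t 0 n := by
    apply steps q
    rw [show p-q+q = p by omega, Nat.zero_add, ← hp1, hq1]
  have h2 : window t (m+q+1) n = window t (m+1) n := by
    apply steps (p-(m+q+1))
    rw [show m+q+1+(p-(m+q+1)) = p by omega, show m+1+(p-(m+q+1)) = p-q by omega, h1, hp1]
  exact (step _ _ h2).1

theorem aper {t u : ℕ → A} (hr : Rec t) (hC : ∀ n, C t u n) (hap : ¬ UltimatelyPeriodic t) :
    (∀ l : List A, IsFactor u l ↔ IsFactor t l) ∧
        (∀ w : List A, LeftSpecial u w → w = window u 0 w.length) := by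
  have hls : ∀ n, LeftSpecial t (window u 0 n) := by
    intro n
    obtain ⟨w, hw, h⟩ := exists_ls hr hap n
    have := ls_prefix hC w h
    rw [hw] at this
    rwa [← this]
  have hrev : ∀ l : List A, IsFactor t l → IsFactor t l.reverse :=
    fun l h => reversal hr hC _ l rfl h
  have hut : ∀ l : List A, IsFactor u l → IsFactor t l := by
    rintro l ⟨i, h⟩
    have := ls_fac (hls (i + l.length))
    rw [window_add, Nat.zero_add, ← h] at this
    exact (fac_append this).2
  refine ⟨fun l => ⟨hut l, ?_⟩, ?_⟩
  · induction l using List.reverseRecOn with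
    | nil => intro _; exact ⟨0, by simp [window]⟩
    | append_singleton g x ih =>
      intro hf
      obtain ⟨i0, hi0⟩ := ih (fac_append hf).1
      have hz : IsFactor u (g ++ [u (i0 + g.length)]) := by
        refine ⟨i0, ?_⟩
        rw [List.length_append, List.length_singleton, window_succ, ← hi0]
      by_cases hzx : u (i0 + g.length) = x
      · rwa [hzx] at hz
      have r1 := hrev _ hf
      have r2 := hrev _ (hut _ hz)
      simp only [List.reverse_append, List.reverse_singleton, List.singleton_append] at r1 r2
      have hg := ls_prefix hC _ ⟨_, _, hzx, r2, r1⟩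
      rw [List.length_reverse] at hg
      obtain ⟨i, hi⟩ := r1
      rw [List.length_cons, List.length_reverse, window_cons] at hi
      obtain ⟨hx, hi⟩ := List.cons.inj hi
      rw [hg, eq_comm, window_eq] at hi
      obtain ⟨j, hj, hjf⟩ := hr _ hf (i+1)
      rw [List.length_append, List.length_singleton] at hjf
      by_cases hagree : ∀ k < j + g.length + 1, t (i+1+k) = u k
      · rw [hjf, show window t j (g.length+1) = window u (j-(i+1)) (g.length+1) by
          rw [window_eq]
          intro k hk
          rw [← hagree _ (by omega)]
          congr 1; omega]
        exact fac_window _ _ _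
      · classical
        have hex : ∃ k, t (i+1+k) ≠ u k := by
          push Not at hagree
          obtain ⟨k, _, h⟩ := hagree
          exact ⟨k, h⟩
        have hl := Nat.find_spec hex
        have hmin : ∀ k < Nat.find hex, t (i+1+k) = u k :=
          fun k hk => not_not.1 (Nat.find_min hex hk)
        generalize Nat.find hex = l at hl hmin
        have hul := ((C_iff t u l).1 (hC l) i hmin).resolve_right hl
        have hgl : g.length ≤ l := by
          by_contra hlt
          exact hl (by simpa using hi l (by omega))
        have f1 : IsFactor t (window u 0 l ++ [u l]) := by
          have := ls_fac (hls (l+1))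
          rwa [window_succ, Nat.zero_add] at this
        have f2 : IsFactor t (window u 0 l ++ [t (i+1+l)]) := by
          have : window u 0 l = window t (i+1) l := by
            rw [eq_comm, window_eq]; simpa using hmin
          rw [this, ← window_succ]; exact fac_window _ _ _
        have r3 := hrev _ f1
        have r4 := hrev _ f2
        simp only [List.reverse_append, List.reverse_singleton, List.singleton_append] at r3 r4
        have hq := ls_prefix hC _ ⟨_, _, hl, r4, r3⟩
        rw [List.length_reverse, len_window] at hq
        obtain ⟨r, rfl⟩ := Nat.exists_eq_add_of_le hgl
        have hfin := fac_window u 0 (g.length + r + 1)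
        rw [window_succ, ← hq, window_add, List.reverse_append, ← hg, List.reverse_reverse,
          Nat.zero_add, Nat.zero_add, ← hul, ← hx, List.append_assoc] at hfin
        exact (fac_append hfin).2
  · rintro w ⟨x, y, hxy, h1, h2⟩
    exact ls_prefix hC w ⟨x, y, hxy, hut _ h1, hut _ h2⟩

theorem shift_iter (t : ℕ → A) (i n : ℕ) : shiftMap^[i] t n = t (i+n) := by
  induction i generalizing n with
  | zero => simp
  | succ i ih =>
    rw [Function.iterate_succ_apply', shiftMap, ih]
    congr 1; omega

theorem order_iff (d : ℕ) (hd : 2 ≤ d) (hd0 : 0 < d) (t u : ℕ → Fin d) :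
    (∀ σ : Equiv.Perm (Fin d), ∀ i : ℕ,
        SeqLe (fun n => σ (pre (σ⁻¹ ⟨0, hd0⟩) u n))
          (fun n => σ (shiftMap^[i] t n))) ↔ ∀ n, C t u n := by
  simp only [shift_iter]
  constructor
  · intro h n
    rw [C_iff]
    intro i hi
    by_contra hcon
    push Not at hcon
    obtain ⟨hay, hxy⟩ := hcon
    let z : Fin d := ⟨0, hd0⟩
    let e : Fin d := ⟨d-1, by omega⟩
    have hze : z ≠ e := by
      intro h; have := congrArg Fin.val h; simp [z, e] at this; omega
    obtain ⟨σ, h1, h2⟩ : ∃ σ : Equiv.Perm (Fin d), σ (t i) = z ∧ σ (u n) = e := by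
      refine ⟨Equiv.swap (Equiv.swap (t i) z (u n)) e * Equiv.swap (t i) z, ?_, ?_⟩
      · rw [Equiv.Perm.mul_apply, Equiv.swap_apply_left]
        apply Equiv.swap_apply_of_ne_of_ne _ hze
        intro hh
        have : Equiv.swap (t i) z (t i) = Equiv.swap (t i) z (u n) := by
          rw [Equiv.swap_apply_left]; exact hh
        exact hay ((Equiv.swap (t i) z).injective this)
      · rw [Equiv.Perm.mul_apply, Equiv.swap_apply_left]
    have hinv : σ⁻¹ ⟨0, hd0⟩ = t i := by
      rw [Equiv.Perm.inv_eq_iff_eq]; exact h1.symm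
    have hlt : σ (t (i+1+n)) < σ (u n) := by
      have hne : σ (t (i+1+n)) ≠ e := by
        rw [← h2]; exact fun hh => hxy (σ.injective hh)
      rw [h2]
      refine lt_of_le_of_ne ?_ hne
      rw [Fin.le_def]
      have := (σ (t (i+1+n))).isLt
      simp only [e]; omega
    have hs := h σ i
    rw [hinv] at hs
    have heq : t (i+(n+1)) = t (i+1+n) := by congr 1; omega
    rcases hs with hs | ⟨k, hk1, hk2⟩
    · have := hs (n+1)
      simp only [pre, heq] at this
      exact hlt.ne' this
    · rcases Nat.lt_trichotomy k (n+1) with hk | hk | hk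
      · rcases k with _ | k
        · simp [pre] at hk2
        · simp only [pre] at hk2
          rw [show i+(k+1) = i+1+k by omega, hi k (by omega)] at hk2
          exact lt_irrefl _ hk2
      · subst hk
        simp only [pre, heq] at hk2
        exact lt_asymm hlt hk2
      · have := hk1 (n+1) hk
        simp only [pre, heq] at this
        exact hlt.ne' this
  · intro h σ i
    have h0 : σ (σ⁻¹ ⟨0, hd0⟩) = ⟨0, hd0⟩ := by simp
    have hpos : ∀ b, b ≠ σ⁻¹ ⟨0, hd0⟩ → σ (σ⁻¹ ⟨0, hd0⟩) < σ b := by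
      intro b hb
      refine lt_of_le_of_ne ?_ (fun hh => hb (σ.injective hh).symm)
      rw [h0, Fin.le_def]; exact Nat.zero_le _
    by_cases ha : t i = σ⁻¹ ⟨0, hd0⟩
    · by_cases hall : ∀ n, t (i+1+n) = u n
      · left
        rintro (_ | n)
        · simp only [pre, Nat.add_zero, ha]
        · simp only [pre]
          rw [← hall, show i+(n+1) = i+1+n by omega]
      · push Not at hall
        classical
        have hl := Nat.find_spec hall
        have hmin : ∀ k < Nat.find hall, t (i+1+k) = u k :=
          fun k hk => not_not.1 (Nat.find_min hall hk)
        generalize Nat.find hall = l at hl hmin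
        have hul := ((C_iff t u l).1 (h l) i hmin).resolve_right hl
        right
        refine ⟨l+1, ?_, ?_⟩
        · rintro (_ | k) hk
          · simp only [pre, Nat.add_zero, ha]
          · simp only [pre]
            rw [← hmin k (by omega), show i+(k+1) = i+1+k by omega]
        · simp only [pre]
          rw [← hul, ha, show i+(l+1) = i+1+l by omega]
          apply hpos
          rw [← ha, hul]; exact hl
    · right
      refine ⟨0, by simp, ?_⟩
      simp only [pre, Nat.add_zero]
      exact hpos _ ha

end Epi

/-- A recurrent sequence `t` over `{0,…,d−1}` is episturmian iff there is a
sequence `u` such that for every permutation `σ` and every `i ≥ 0`,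
`σ∘(a·u) ≤ σ∘(Tⁱ t)` lexicographically, where `a = σ⁻¹(0)`.  Moreover, if `t`
is aperiodic then `u` has the same factors as `t` and every left special factor
of `u` is a prefix of `u`. -/
theorem stmt14 (d : ℕ) (hd : 2 ≤ d) (t : ℕ → Fin d)
    (hrec : ∀ l : List (Fin d), IsFactor t l → ∀ N, ∃ i ≥ N, l = window t i l.length) :
    (((∀ l : List (Fin d), IsFactor t l → IsFactor t l.reverse) ∧
        ∀ w w' : List (Fin d), w.length = w'.length →
          LeftSpecial t w → LeftSpecial t w' → w = w') ↔
      (∃ u : ℕ → Fin d, ∀ σ : Equiv.Perm (Fin d), ∀ i : ℕ,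
        SeqLe (fun n => σ (pre (σ⁻¹ ⟨0, by omega⟩) u n))
          (fun n => σ (shiftMap^[i] t n)))) ∧
    (¬ UltimatelyPeriodic t →
      ∀ u : ℕ → Fin d,
        (∀ σ : Equiv.Perm (Fin d), ∀ i : ℕ,
          SeqLe (fun n => σ (pre (σ⁻¹ ⟨0, by omega⟩) u n))
            (fun n => σ (shiftMap^[i] t n))) →
        (∀ l : List (Fin d), IsFactor u l ↔ IsFactor t l) ∧
        (∀ w : List (Fin d), LeftSpecial u w → w = window u 0 w.length)) := by
  have hd0 : 0 < d := Nat.lt_of_lt_of_le Nat.zero_lt_two hd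
  simp only [Epi.order_iff d hd hd0]
  refine ⟨⟨?_, ?_⟩, ?_⟩
  · rintro ⟨hrev, huniq⟩
    obtain ⟨u, H1, H2⟩ := Epi.exists_u huniq
    exact ⟨u, Epi.C_of_epi hrec hrev huniq H1 H2⟩
  · rintro ⟨u, hC⟩
    refine ⟨fun l h => Epi.reversal hrec hC _ l rfl h, fun w w' hl h1 h2 => ?_⟩
    rw [Epi.ls_prefix hC w h1, Epi.ls_prefix hC w' h2, hl]
  · intro hap u hC
    exact Epi.aper hrec hC hap
end

section
/- Let b ≥ 2 be an integer and let ξ be an irrational real number. Then the fractional parts {ξ b^n}, n ≥ 0, cannot all lie in an interval of length less than 1/b: for every real t and every c with 0 ≤ c < 1/b, there exists n ≥ 0 such that {ξ b^n} ∉ [t, t + c]. -/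
/-- For an integer `b ≥ 2` and irrational `ξ`, the fractional parts `{ξ bⁿ}`
cannot all lie in an interval of length `< 1/b`. -/
theorem stmt15 (b : ℕ) (hb : 2 ≤ b) (ξ : ℝ) (hξ : Irrational ξ) :
    ∀ t c : ℝ, 0 ≤ c → c < 1 / b →
      ∃ n : ℕ, Int.fract (ξ * (b : ℝ) ^ n) ∉ Set.Icc t (t + c) := by
  intro t c hc hcb
  by_contra! hcon
  have hb0 : (0:ℝ) < b := by positivity
  have hb1 : (1:ℝ) < b := by exact_mod_cast (by omega : 1 < b)
  have hbc : c * b < 1 := by rwa [lt_div_iff₀ hb0] at hcb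
  obtain ⟨x, hx⟩ : ∃ x : ℕ → ℝ, ∀ n, x n = Int.fract (ξ * (b : ℝ) ^ n) := ⟨_, fun _ => rfl⟩
  obtain ⟨δ, hδ⟩ : ∃ δ : ℝ, δ = 1 - c * b := ⟨_, rfl⟩
  have hδ0 : 0 < δ := by linarith
  have hxI : ∀ n, x n ∈ Set.Icc t (t + c) := fun n => by rw [hx]; exact hcon n
  have hstep : ∀ n, ∃ k : ℤ, x (n + 1) = b * x n - k := by
    intro n
    refine ⟨⌊ξ * (b : ℝ) ^ (n+1)⌋ - b * ⌊ξ * (b : ℝ) ^ n⌋, ?_⟩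
    rw [hx, hx, Int.fract, Int.fract]
    push_cast
    ring
  have hexp : ∀ m l, |x (m + 1) - x (l + 1)| < δ → x (m + 1) - x (l + 1) = b * (x m - x l) := by
    intro m l h
    obtain ⟨k, hk⟩ := hstep m
    obtain ⟨k', hk'⟩ := hstep l
    have h1 := hxI m
    have h2 := hxI l
    have h3 : |x m - x l| ≤ c := by
      rw [abs_le]; constructor <;> linarith [h1.1, h1.2, h2.1, h2.2]
    have h4 : |b * (x m - x l)| ≤ c * b := by
      rw [abs_mul, abs_of_pos hb0, mul_comm]; gcongr
    have h5 : |((k - k' : ℤ) : ℝ)| < 1 := by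
      have : ((k - k' : ℤ) : ℝ) = b * (x m - x l) - (x (m+1) - x (l+1)) := by
        push_cast; rw [hk, hk']; ring
      rw [this]
      have h8 := abs_le.mp h4
      have h9 := abs_lt.mp h
      rw [abs_lt]; constructor <;> linarith [h8.1, h8.2, h9.1, h9.2]
    have h6 : k - k' = 0 := by
      rw [← Int.abs_lt_one_iff]; exact_mod_cast h5
    have h7 : (k : ℝ) = k' := by exact_mod_cast sub_eq_zero.mp h6
    rw [hk, hk', h7]; ring
  have hiter : ∀ n i j, |x (i + n) - x (j + n)| < δ → |x i - x j| * b ^ n < δ := by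
    intro n
    induction n with
    | zero => intro i j h; simpa using h
    | succ n ih =>
      intro i j h
      have e := hexp (i + n) (j + n) h
      have h' : |x (i + (n + 1)) - x (j + (n + 1))| = b * |x (i + n) - x (j + n)| := by
        rw [← add_assoc, ← add_assoc, e, abs_mul, abs_of_pos hb0]
      have h2 := ih (i + 1) (j + 1) (by
        rw [add_right_comm, add_right_comm j]; exact h)
      have hp : (1:ℝ) ≤ b ^ n := one_le_pow₀ hb1.le
      have h3 : |x (i + 1) - x (j + 1)| < δ := by
        nlinarith [abs_nonneg (x (i + 1) - x (j + 1))]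
      rw [hexp i j h3, abs_mul, abs_of_pos hb0] at h2
      rw [pow_succ]; linarith
  have hinj : ∀ i j, i < j → x i ≠ x j := by
    intro i j hij h
    rw [hx, hx, Int.fract_eq_fract] at h
    obtain ⟨z, hz⟩ := h
    have hpow : b ^ i < b ^ j := Nat.pow_lt_pow_right (by omega) hij
    have hne : ((b:ℤ) ^ i - (b:ℤ) ^ j) ≠ 0 := by
      have : (b:ℤ) ^ i < (b:ℤ) ^ j := by exact_mod_cast hpow
      omega
    have := hξ.mul_intCast hne
    apply this.ne_int z
    push_cast
    linarith
  obtain ⟨M, hM⟩ : ∃ M : ℕ, M = ⌊1 / δ⌋₊ + 1 := ⟨_, rfl⟩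
  have hpig : ∀ n, ∃ p : Fin (M + 1) × Fin (M + 1), p.1 < p.2 ∧
      |x (p.1 + n) - x (p.2 + n)| < δ := by
    intro n
    let f : Fin (M + 1) → Fin M := fun i => ⟨⌊x (i + n) / δ⌋₊, by
      refine lt_of_lt_of_eq (Nat.lt_succ_of_le ?_) hM.symm
      apply Nat.floor_le_floor
      gcongr
      rw [hx]; exact (Int.fract_lt_one _).le⟩
    obtain ⟨i, j, hij, hf⟩ := Fintype.exists_ne_map_eq_of_card_lt f (by simp)
    have key : |x (i + n) - x (j + n)| < δ := by
      have hf' : ⌊x (i + n) / δ⌋₊ = ⌊x (j + n) / δ⌋₊ := congrArg Fin.val hf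
      have hnn : ∀ m, 0 ≤ x m / δ := fun m => by
        apply div_nonneg _ hδ0.le; rw [hx]; exact Int.fract_nonneg _
      have a1 := Nat.floor_le (hnn (i + n))
      have a2 := Nat.lt_floor_add_one (x (i + n) / δ)
      have a3 := Nat.floor_le (hnn (j + n))
      have a4 := Nat.lt_floor_add_one (x (j + n) / δ)
      rw [hf'] at a1 a2
      have : |x (i + n) / δ - x (j + n) / δ| < 1 := by
        rw [abs_lt]; constructor <;> linarith
      rw [← sub_div, abs_div, abs_of_pos hδ0, div_lt_one hδ0] at this
      exact this
    rcases lt_or_gt_of_ne hij with h | h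
    · exact ⟨(i, j), h, key⟩
    · exact ⟨(j, i), h, by rw [abs_sub_comm]; exact key⟩
  choose p hp1 hp2 using hpig
  obtain ⟨q, hq⟩ := Finite.exists_infinite_fiber p
  rw [Set.infinite_coe_iff] at hq
  have hlt : q.1 < q.2 := by
    obtain ⟨n, hn⟩ := hq.nonempty
    have : p n = q := hn
    rw [← this]; exact hp1 n
  have hpos : 0 < |x q.1 - x q.2| := abs_pos.mpr (sub_ne_zero.mpr (hinj _ _ hlt))
  obtain ⟨N, hN⟩ := pow_unbounded_of_one_lt (δ / |x q.1 - x q.2|) hb1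
  obtain ⟨n, hn, hnN⟩ := hq.exists_gt N
  have hn' : p n = q := hn
  have h1 := hp2 n
  rw [hn'] at h1
  have h2 := hiter n _ _ h1
  rw [div_lt_iff₀ hpos] at hN
  have h3 : (b:ℝ) ^ N ≤ b ^ n := pow_le_pow_right₀ hb1.le hnN.le
  nlinarith
end

section
/- Let b ≥ 2 be an integer and let ξ be a positive irrational real number. Define the base-b digit sequence of the fractional part of ξ by d(n) = ⌊b·{ξ b^n}⌋ for n ≥ 0. Then there exists a closed interval of length 1/b containing {ξ b^n} for all n ≥ 0 (i.e., there is a real t with {ξ b^n} ∈ [t, t + 1/b] for all n ≥ 0) if and only if there exists an integer k with 0 ≤ k ≤ b − 2 such that d(n) ∈ {k, k+1} for all n ≥ 0 and the sequence (d(n))_{n≥0} is Sturmian (it has exactly m + 1 distinct factors of each length m ≥ 1). -/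
theorem win_eq (s : ℕ → ℤ) (i j m : ℕ) :
    window s i m = window s j m ↔ ∀ l < m, s (i + l) = s (j + l) := by
  simp [window]

theorem win_len (s : ℕ → ℤ) (i m : ℕ) : (window s i m).length = m := by
  simp [window]

theorem win_snoc (s : ℕ → ℤ) (i m : ℕ) :
    window s i (m + 1) = window s i m ++ [s (i + m)] := by
  simp [window, List.range_succ]

theorem win_cons (s : ℕ → ℤ) (i m : ℕ) :
    window s i (m + 1) = s i :: window s (i + 1) m := by
  simp only [window, List.range_succ_eq_map, List.map_cons, List.map_map]
  congr 1
  apply List.map_congr_left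
  intro a _
  simp only [Function.comp]
  congr 1
  omega

theorem cpl_eq (s : ℕ → ℤ) (m : ℕ) :
    complexity s m = (Set.range fun i => window s i m).ncard := by
  unfold complexity
  congr 1
  ext l
  constructor
  · rintro ⟨h, i, hi⟩
    exact ⟨i, by rw [h] at hi; exact hi.symm⟩
  · rintro ⟨i, rfl⟩
    exact ⟨win_len s i m, i, by rw [win_len]⟩

theorem fin_range (s : ℕ → ℤ) (a b : ℤ) (hab : ∀ n, s n = a ∨ s n = b) (m : ℕ) :
    (Set.range fun i => window s i m).Finite := by
  induction m with
  | zero => 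
    refine (Set.finite_singleton ([] : List ℤ)).subset ?_
    rintro _ ⟨i, rfl⟩
    simp [window]
  | succ m ih =>
    refine ((ih.image (fun l => a :: l)).union (ih.image (fun l => b :: l))).subset ?_
    rintro _ ⟨i, rfl⟩
    simp only [win_cons]
    rcases hab i with h | h
    · left; exact ⟨_, ⟨i + 1, rfl⟩, by simp [h]⟩
    · right; exact ⟨_, ⟨i + 1, rfl⟩, by simp [h]⟩

theorem cpl_zero (s : ℕ → ℤ) : complexity s 0 = 1 := by
  rw [cpl_eq]
  simp [window]

theorem per_of (s : ℕ → ℤ) (m i q : ℕ) (hq : 1 ≤ q)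
    (h0 : window s i m = window s (i + q) m)
    (hd : ∀ r < q, ∀ i', window s i' m = window s (i + r) m → s (i' + m) = s (i + r + m)) :
    ∀ r, window s (i + r) (m + 1) = window s (i + r + q) (m + 1) := by
  have key : ∀ r, window s (i + r) m = window s (i + r + q) m →
      window s (i + r) (m + 1) = window s (i + r + q) (m + 1) →
      window s (i + (r + 1)) m = window s (i + (r + 1) + q) m := by
    intro r _ h
    rw [win_cons, win_cons] at h
    have := (List.cons.inj h).2
    rw [show i + (r + 1) = i + r + 1 by omega, show i + r + 1 + q = i + r + q + 1 by omega]
    exact this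
  have det : ∀ r, (∀ r' < r, window s (i + r') m = window s (i + r' + q) m) →
      ∀ i', window s i' m = window s (i + r) m → s (i' + m) = s (i + r + m) := by
    intro r
    induction r using Nat.strong_induction_on with
    | _ r ih =>
      intro hr i' hi'
      by_cases hlt : r < q
      · exact hd r hlt i' hi'
      · have e : i + (r - q) + q = i + r := by omega
        have h1 := hr (r - q) (by omega)
        rw [e] at h1
        have h2 := ih (r - q) (by omega) (fun r' h' => hr r' (by omega))
        rw [h2 i' (hi'.trans h1.symm), h2 (i + r) h1.symm]
  have main : ∀ r, window s (i + r) m = window s (i + r + q) m := by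
    intro r
    induction r using Nat.strong_induction_on with
    | _ r ih =>
      cases r with
      | zero => simpa using h0
      | succ r =>
        refine key r (ih r (by omega)) ?_
        have := ih r (by omega)
        rw [win_snoc, win_snoc, this, det r (fun r' h' => ih r' (by omega)) _ this.symm]
  intro r
  rw [win_snoc, win_snoc, main r, det r (fun r' _ => main r') _ (main r).symm]

theorem rs_unique (s : ℕ → ℤ) (m : ℕ)
    (hfin : (Set.range fun i => window s i (m + 1)).Finite)
    (hc : complexity s (m + 1) ≤ complexity s m + 1) (i i' j j' : ℕ)
    (hi : window s i m = window s i' m) (hi' : s (i + m) ≠ s (i' + m))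
    (hj : window s j m = window s j' m) (hj' : s (j + m) ≠ s (j' + m)) :
    window s i m = window s j m := by
  by_contra hne
  rw [cpl_eq, cpl_eq] at hc
  set X := Set.range fun i => window s i (m + 1) with hX
  have hsub : (Set.range fun i => window s i m) ⊆
      List.dropLast '' ((X \ {window s i (m + 1)}) \ {window s j (m + 1)}) := by
    rintro _ ⟨n, rfl⟩
    have dl : ∀ n, (window s n (m + 1)).dropLast = window s n m := by
      intro n; rw [win_snoc]; simp
    have ne1 : ∀ a b, window s a m ≠ window s b m → window s a (m + 1) ≠ window s b (m + 1) := by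
      intro a b h h'
      exact h (by rw [← dl a, ← dl b, h'])
    have ne2 : ∀ a b, s (a + m) ≠ s (b + m) → window s a (m + 1) ≠ window s b (m + 1) := by
      intro a b h h'
      exact h ((win_eq _ _ _ _).1 h' m (by omega))
    by_cases h1 : window s n m = window s i m
    · refine ⟨window s i' (m + 1), ⟨⟨⟨i', rfl⟩, ne2 _ _ hi'.symm⟩, ne1 _ _ ?_⟩, ?_⟩
      · rw [← hi]; exact hne
      · rw [dl]; exact (h1.trans hi).symm
    · by_cases h2 : window s n m = window s j m
      · refine ⟨window s j' (m + 1), ⟨⟨⟨j', rfl⟩, ne1 _ _ ?_⟩, ne2 _ _ hj'.symm⟩, ?_⟩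
        · rw [← hj]; exact fun h => hne h.symm
        · rw [dl]; exact (h2.trans hj).symm
      · exact ⟨window s n (m + 1), ⟨⟨⟨n, rfl⟩, ne1 _ _ h1⟩, ne1 _ _ h2⟩, dl n⟩
  have f1 : (X \ {window s i (m + 1)}).Finite := hfin.subset Set.sdiff_subset
  have f2 : ((X \ {window s i (m + 1)}) \ {window s j (m + 1)}).Finite :=
    f1.subset Set.sdiff_subset
  have c1 := Set.ncard_sdiff_singleton_add_one (a := window s i (m + 1)) (s := X) ⟨i, rfl⟩ hfin
  have c2 := Set.ncard_sdiff_singleton_add_one (a := window s j (m + 1))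
    (s := X \ {window s i (m + 1)}) ⟨⟨j, rfl⟩, by
      intro h
      apply hne
      have h : window s j (m + 1) = window s i (m + 1) := h
      rw [win_eq] at h ⊢
      exact fun l hl => (h l (by omega)).symm⟩ f1
  have c3 := (Set.ncard_le_ncard hsub (f2.image _)).trans (Set.ncard_image_le f2)
  omega

theorem cpl_lt (s : ℕ → ℤ) (a b : ℤ) (hab : ∀ n, s n = a ∨ s n = b)
    (hap : ∀ i q, 1 ≤ q → ¬ ∀ r, s (i + r) = s (i + r + q)) (m : ℕ) :
    complexity s m < complexity s (m + 1) := by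
  by_contra hcon
  push Not at hcon
  have hf := fin_range s a b hab m
  have hf1 := fin_range s a b hab (m + 1)
  rw [cpl_eq, cpl_eq] at hcon
  have dl : ∀ n, (window s n (m + 1)).dropLast = window s n m := by
    intro n; rw [win_snoc]; simp
  have himg : List.dropLast '' (Set.range fun i => window s i (m + 1)) =
      Set.range fun i => window s i m := by
    ext l
    constructor
    · rintro ⟨_, ⟨n, rfl⟩, rfl⟩
      exact ⟨n, (dl n).symm⟩
    · rintro ⟨n, rfl⟩
      exact ⟨_, ⟨n, rfl⟩, dl n⟩
  have hinj : Set.InjOn List.dropLast (Set.range fun i => window s i (m + 1)) := by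
    apply Set.injOn_of_ncard_image_eq _ hf1
    apply le_antisymm (Set.ncard_image_le hf1)
    rw [himg]; exact hcon
  have : ¬ Function.Injective (fun i => window s i m) := by
    intro hi
    exact Set.infinite_range_of_injective hi hf
  simp only [Function.Injective, not_forall] at this
  obtain ⟨i, j, hij, hne⟩ := this
  have hd : ∀ i j, window s i m = window s j m → s (i + m) = s (j + m) := by
    intro i j h
    have := hinj ⟨i, rfl⟩ ⟨j, rfl⟩ (by simp only [dl]; exact h)
    exact (win_eq _ _ _ _).1 this m (by omega)
  have gen : ∀ i j, i < j → window s i m = window s j m → False := by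
    intro i j hlt h
    have := per_of s m i (j - i) (by omega) (by rw [show i + (j - i) = j by omega]; exact h)
      (fun r _ i' h' => hd _ _ h')
    exact hap i (j - i) (by omega) fun r => (win_eq _ _ _ _).1 (this r) 0 (by omega)
  rcases lt_or_gt_of_ne hne with h | h
  · exact gen i j h hij
  · exact gen j i h hij.symm

theorem cpl_le (s : ℕ → ℤ) (a b : ℤ) (hab : ∀ n, s n = a ∨ s n = b) (m : ℕ)
    (hls : ∀ i j i' j', s i = a → s j = b → s i' = a → s j' = b →
      window s (i + 1) m = window s (j + 1) m → window s (i' + 1) m = window s (j' + 1) m →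
      window s (i + 1) m = window s (i' + 1) m) :
    complexity s (m + 1) ≤ complexity s m + 1 := by
  have hf := fin_range s a b hab m
  have hf1 := fin_range s a b hab (m + 1)
  rw [cpl_eq, cpl_eq]
  have tl : ∀ n, (window s n (m + 1)).tail = window s (n + 1) m := by
    intro n; rw [win_cons]; simp
  have himg : ∀ Y ⊆ (Set.range fun i => window s i (m + 1)), List.tail '' Y ⊆
      Set.range fun i => window s i m := by
    rintro Y hY _ ⟨y, hy, rfl⟩
    obtain ⟨n, rfl⟩ := hY hy
    exact ⟨n + 1, (tl n).symm⟩
  have hcount : ∀ Y ⊆ (Set.range fun i => window s i (m + 1)), Set.InjOn List.tail Y →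
      Y.ncard ≤ (Set.range fun i => window s i m).ncard := by
    intro Y hY hi
    rw [← hi.ncard_image]
    exact Set.ncard_le_ncard (himg Y hY) hf
  by_cases hex : ∃ i j, s i = a ∧ s j = b ∧ window s (i + 1) m = window s (j + 1) m
  · obtain ⟨i, j, hi, hj, hij⟩ := hex
    have c1 := Set.ncard_sdiff_singleton_add_one (a := window s j (m + 1))
      (s := Set.range fun i => window s i (m + 1)) ⟨j, rfl⟩ hf1
    rw [← c1]
    apply Nat.add_le_add_right
    apply hcount _ Set.sdiff_subset
    rintro _ ⟨⟨u, rfl⟩, hu⟩ _ ⟨⟨v, rfl⟩, hv⟩ huv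
    have hu : window s u (m + 1) ≠ window s j (m + 1) := hu
    have hv : window s v (m + 1) ≠ window s j (m + 1) := hv
    have huv : (window s u (m + 1)).tail = (window s v (m + 1)).tail := huv
    show window s u (m + 1) = window s v (m + 1)
    rw [tl, tl] at huv
    rw [win_cons, win_cons s j] at hu hv
    rw [win_cons, win_cons, huv]
    rcases hab u with h1 | h1 <;> rcases hab v with h2 | h2
    · rw [h1, h2]
    · exfalso
      have := hls i j u v hi hj h1 h2 hij huv
      apply hv
      rw [h2, hj, ← huv, ← this, hij]
    · exfalso
      have := hls i j v u hi hj h2 h1 hij huv.symm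
      apply hu
      rw [h1, hj, huv, ← this, hij]
    · rw [h1, h2]
  · refine (hcount _ subset_rfl ?_).trans (Nat.le_succ _)
    rintro _ ⟨u, rfl⟩ _ ⟨v, rfl⟩ huv
    have huv : (window s u (m + 1)).tail = (window s v (m + 1)).tail := huv
    show window s u (m + 1) = window s v (m + 1)
    rw [tl, tl] at huv
    rw [win_cons, win_cons, huv]
    rcases hab u with h1 | h1 <;> rcases hab v with h2 | h2
    · rw [h1, h2]
    · exact absurd ⟨u, v, h1, h2, huv⟩ hex
    · exact absurd ⟨v, u, h2, h1, huv.symm⟩ hex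
    · rw [h1, h2]

theorem pair_per (s : ℕ → ℤ) (a b : ℤ) (hne : a ≠ b) (hab : ∀ n, s n = a ∨ s n = b)
    (hc : ∀ m, complexity s m = m + 1) (L i j : ℕ) (hi : s i = b) (hj : s j = a)
    (hij : window s (i + 1) L = window s (j + 1) L)
    (hi' : s (i + 1 + L) = b) (hj' : s (j + 1 + L) = a)
    (hpal : ∀ l < L, s (j + 1 + l) = s (j + L - l))
    (hns : ∀ i', window s i' (L + 1) = window s j (L + 1) → s (i' + (L + 1)) = a) :
    ∃ N q, 1 ≤ q ∧ ∀ r, s (N + r) = s (N + r + q) := by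
  have hf := fin_range s a b hab
  have nooc : ∀ p ≤ L + 1, window s (j + p) (L + 1) ≠ window s i (L + 1) := by
    intro p hp h
    rw [win_cons, win_cons, hij] at h
    obtain ⟨h1, h2⟩ := List.cons.inj h
    rw [hi] at h1
    rw [win_eq] at h2
    rcases Nat.eq_zero_or_pos p with h0 | h0
    · subst h0; exact hne (hj.symm.trans h1)
    · by_cases h3 : p = L + 1
      · subst h3
        exact hne (hj'.symm.trans (by rw [← h1]; congr 1; omega))
      · have e1 := h2 (L - p) (by omega)
        have e2 := hpal (L - p) (by omega)
        rw [show j + p + 1 + (L - p) = j + 1 + L by omega, hj', e2,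
          show j + L - (L - p) = j + p by omega, h1] at e1
        exact hne e1
  -- pigeonhole
  set Y := (Set.range fun i => window s i (L + 1)) \ {window s i (L + 1)} with hY
  have hYf : Y.Finite := (hf (L + 1)).subset Set.sdiff_subset
  have hYc : Y.ncard = L + 1 := by
    have c1 := Set.ncard_sdiff_singleton_add_one (a := window s i (L + 1))
      (s := Set.range fun i => window s i (L + 1)) ⟨i, rfl⟩ (hf (L + 1))
    rw [← hY, ← cpl_eq, hc] at c1
    omega
  have : ∃ x ∈ Finset.range (L + 2), ∃ y ∈ Finset.range (L + 2), x ≠ y ∧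
      window s (j + x) (L + 1) = window s (j + y) (L + 1) := by
    apply Finset.exists_ne_map_eq_of_card_lt_of_maps_to (t := hYf.toFinset)
    · rw [← Set.ncard_eq_toFinset_card Y hYf, hYc]; simp
    · intro p hp
      have hp : p < L + 2 := by simpa using hp
      simp only [Set.Finite.coe_toFinset]
      exact ⟨⟨j + p, rfl⟩, nooc p (by omega)⟩
  obtain ⟨x, hx, y, hy, hxy, hw⟩ := this
  have gen : ∀ x y, x < y → y < L + 2 → window s (j + x) (L + 1) = window s (j + y) (L + 1) →
      ∃ N q, 1 ≤ q ∧ ∀ r, s (N + r) = s (N + r + q) := by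
    intro x y hxy hy hw
    refine ⟨j + x, y - x, by omega, ?_⟩
    have := per_of s (L + 1) (j + x) (y - x) (by omega)
      (by rw [show j + x + (y - x) = j + y by omega]; exact hw) ?_
    · exact fun r => (win_eq _ _ _ _).1 (this r) 0 (by omega)
    intro r hr i' hi2
    by_contra hcon
    have hi3 := hi2
    rw [win_cons, win_cons] at hi3
    obtain ⟨g1, g2⟩ := List.cons.inj hi3
    have := rs_unique s L (hf _) (by rw [hc, hc]) (i' + 1) (j + x + r + 1) (i + 1) (j + 1) g2
      (by rw [show i' + 1 + L = i' + (L + 1) by omega,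
        show j + x + r + 1 + L = j + x + r + (L + 1) by omega]; exact hcon) hij
      (by rw [hi', hj']; exact hne.symm)
    rcases hab i' with h | h
    · have e1 : window s i' (L + 1) = window s j (L + 1) := by
        rw [win_cons, win_cons s j, this, hij, h, hj]
      have := hns _ e1
      have := hns _ (hi2.symm.trans e1)
      apply hcon
      simp_all
    · apply nooc (x + r) (by omega)
      rw [show j + (x + r) = j + x + r by omega, ← hi2, win_cons, win_cons s i, this, h, hi]
  simp only [Finset.mem_range] at hx hy
  rcases lt_or_gt_of_ne hxy with h | h
  · exact gen x y h hy hw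
  · exact gen y x h hx hw.symm

/-- sums -/
def wsum (s : ℕ → ℤ) (i l : ℕ) : ℤ := ∑ j ∈ Finset.range l, s (i + j)

theorem wsum_succ (s : ℕ → ℤ) (i l : ℕ) : wsum s i (l + 1) = wsum s i l + s (i + l) := by
  simp [wsum, Finset.sum_range_succ]

theorem wsum_add (s : ℕ → ℤ) (i l m : ℕ) : wsum s i (l + m) = wsum s i l + wsum s (i + l) m := by
  simp [wsum, Finset.sum_range_add, add_assoc]

theorem wsum_one (s : ℕ → ℤ) (i : ℕ) : wsum s i 1 = s i := by
  simp [wsum]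

theorem no_pair (s : ℕ → ℤ) (k : ℤ) (hab : ∀ n, s n = k ∨ s n = k + 1)
    (hc : ∀ m, complexity s m = m + 1)
    (hap : ∀ i q, 1 ≤ q → ¬ ∀ r, s (i + r) = s (i + r + q))
    (i₀ j₀ L₀ : ℕ) (h1 : s i₀ = k) (h2 : s j₀ = k + 1)
    (h3 : ∀ l < L₀, s (i₀ + 1 + l) = s (j₀ + 1 + l))
    (h4 : s (i₀ + 1 + L₀) = k) (h5 : s (j₀ + 1 + L₀) = k + 1) : False := by
  have hex : ∃ l, ∃ i j, wsum s i l + 2 ≤ wsum s j l := by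
    refine ⟨1 + L₀ + 1, i₀, j₀, ?_⟩
    have : wsum s (i₀ + 1) L₀ = wsum s (j₀ + 1) L₀ :=
      Finset.sum_congr rfl fun l hl => h3 l (by simpa using hl)
    rw [wsum_succ, wsum_succ, wsum_add, wsum_add, wsum_one, wsum_one, this, ← add_assoc,
      ← add_assoc, h1, h2, h4, h5]
    linarith
  classical
  obtain ⟨i, j, hS⟩ := Nat.find_spec hex
  have hmin : ∀ l < Nat.find hex, ∀ i j, wsum s j l ≤ wsum s i l + 1 := by
    intro l hl i j
    have := Nat.find_min hex hl
    push Not at this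
    have := this i j
    omega
  generalize Nat.find hex = M at hS hmin
  have hM : 2 ≤ M := by
    by_contra h
    have : M = 0 ∨ M = 1 := by omega
    rcases this with h | h <;> subst h
    · simp [wsum] at hS
    · rw [wsum_one, wsum_one] at hS
      have := hab i; have := hab j; omega
  obtain ⟨L, rfl⟩ : ∃ L, M = L + 2 := ⟨M - 2, by omega⟩
  have hD : ∀ l, 1 ≤ l → l ≤ L + 1 → wsum s j l = wsum s i l + 1 ∧
      wsum s (j + l) (L + 2 - l) = wsum s (i + l) (L + 2 - l) + 1 := by
    intro l hl hl'
    have a1 := hmin l (by omega) i j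
    have a2 := hmin (L + 2 - l) (by omega) (i + l) (j + l)
    have b1 := wsum_add s i l (L + 2 - l)
    have b2 := wsum_add s j l (L + 2 - l)
    rw [show l + (L + 2 - l) = L + 2 by omega] at b1 b2
    omega
  have hi : s i = k ∧ s j = k + 1 := by
    have := (hD 1 le_rfl (by omega)).1
    rw [wsum_one, wsum_one] at this
    have := hab i; have := hab j; omega
  have hi' : s (i + 1 + L) = k ∧ s (j + 1 + L) = k + 1 := by
    have := (hD (L + 1) (by omega) (by omega)).2
    rw [show L + 2 - (L + 1) = 1 by omega, wsum_one, wsum_one,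
      show i + (L + 1) = i + 1 + L by omega, show j + (L + 1) = j + 1 + L by omega] at this
    have := hab (i + 1 + L); have := hab (j + 1 + L); omega
  have hw : ∀ l < L, s (i + 1 + l) = s (j + 1 + l) := by
    intro l hl
    have e1 := (hD (l + 1) (by omega) (by omega)).1
    have e2 := (hD (l + 1 + 1) (by omega) (by omega)).1
    rw [wsum_succ s j (l + 1), wsum_succ s i (l + 1)] at e2
    rw [show i + 1 + l = i + (l + 1) by omega, show j + 1 + l = j + (l + 1) by omega]
    omega
  have hPQ : ∀ l ≤ L, wsum s (j + 1) l = wsum s (j + 1 + (L - l)) l := by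
    intro l hl
    have hcg : ∀ c, c + l ≤ L → wsum s (i + 1 + c) l = wsum s (j + 1 + c) l := by
      intro c hcl
      refine Finset.sum_congr rfl fun t ht => ?_
      have : t < l := by simpa using ht
      rw [add_assoc, hw _ (by omega), add_assoc _ c]
    have u1 := hcg 0 (by omega)
    have u2 := hcg (L - l) (by omega)
    rw [add_zero, add_zero] at u1
    -- prefix of one word against suffix of the other
    have v1 := hmin (1 + l) (by omega) (i + 1 + (L - l)) j
    have v2 := hmin (l + 1) (by omega) i (j + 1 + (L - l))
    have p1 := wsum_add s j 1 l
    have p2 := wsum_add s i 1 l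
    have p3 := wsum_succ s (j + 1 + (L - l)) l
    have p4 := wsum_succ s (i + 1 + (L - l)) l
    rw [wsum_one] at p1 p2
    rw [show j + 1 + (L - l) + l = j + 1 + L by omega] at p3
    rw [show i + 1 + (L - l) + l = i + 1 + L by omega] at p4
    rw [add_comm 1 l] at v1 p1 p2
    omega
  have hpal : ∀ l < L, s (j + 1 + l) = s (j + L - l) := by
    intro l hl
    have q1 := hPQ l (by omega)
    have q2 := hPQ (l + 1) (by omega)
    rw [wsum_succ s (j + 1), add_comm l 1, wsum_add, wsum_one,
      show j + 1 + (L - (1 + l)) + 1 = j + 1 + (L - l) by omega,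
      show j + 1 + (L - (1 + l)) = j + L - l by omega] at q2
    omega
  have hpal' : ∀ l < L, s (i + 1 + l) = s (i + L - l) := by
    intro l hl
    rw [hw l hl, hpal l hl]
    have := hw (L - 1 - l) (by omega)
    rw [show i + 1 + (L - 1 - l) = i + L - l by omega,
      show j + 1 + (L - 1 - l) = j + L - l by omega] at this
    exact this.symm
  have hwin : window s (i + 1) L = window s (j + 1) L := (win_eq _ _ _ _).2 hw
  have hf := fin_range s k (k + 1) hab
  by_cases c1 : ∀ i', window s i' (L + 1) = window s j (L + 1) → s (i' + (L + 1)) = k + 1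
  · obtain ⟨N, q, hq, h⟩ := pair_per s (k + 1) k (by omega) (fun n => (hab n).symm) hc L i j
      hi.1 hi.2 hwin hi'.1 hi'.2 hpal c1
    exact hap N q hq h
  by_cases c2 : ∀ i', window s i' (L + 1) = window s i (L + 1) → s (i' + (L + 1)) = k
  · obtain ⟨N, q, hq, h⟩ := pair_per s k (k + 1) (by omega) hab hc L j i
      hi.2 hi.1 hwin.symm hi'.2 hi'.1 hpal' c2
    exact hap N q hq h
  push Not at c1 c2
  obtain ⟨u, hu, hu'⟩ := c1
  obtain ⟨v, hv, hv'⟩ := c2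
  have := rs_unique s (L + 1) (hf _) (by rw [hc, hc]) u j v i hu
    (by rw [show j + (L + 1) = j + 1 + L by omega, hi'.2]; exact hu') hv
    (by rw [show i + (L + 1) = i + 1 + L by omega, hi'.1]; exact hv')
  rw [hu, hv] at this
  have := (win_eq _ _ _ _).1 this 0 (by omega)
  simp only [add_zero] at this
  omega

/-- (Bugeaud–Dubickas) For an integer `b ≥ 2` and a positive irrational `ξ`, the
fractional parts `{ξ bⁿ}` all lie in some closed interval of length `1/b` iff
the base-`b` digit sequence of the fractional part of `ξ` is a Sturmian sequence
on `{k, k+1}` for some `0 ≤ k ≤ b − 2`. -/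
theorem stmt16 (b : ℕ) (hb : 2 ≤ b) (ξ : ℝ) (hξpos : 0 < ξ) (hξ : Irrational ξ) :
    (∃ t : ℝ, ∀ n : ℕ, Int.fract (ξ * (b : ℝ) ^ n) ∈ Set.Icc t (t + 1 / b)) ↔
    (∃ k : ℤ, 0 ≤ k ∧ k ≤ (b : ℤ) - 2 ∧
      (∀ n : ℕ, ⌊(b : ℝ) * Int.fract (ξ * (b : ℝ) ^ n)⌋ = k ∨
        ⌊(b : ℝ) * Int.fract (ξ * (b : ℝ) ^ n)⌋ = k + 1) ∧
      (∀ m ≥ 1,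
        complexity (fun n : ℕ => ⌊(b : ℝ) * Int.fract (ξ * (b : ℝ) ^ n)⌋) m = m + 1)) := by
  set x : ℕ → ℝ := fun n => Int.fract (ξ * (b : ℝ) ^ n) with hx
  set d : ℕ → ℤ := fun n => ⌊(b : ℝ) * Int.fract (ξ * (b : ℝ) ^ n)⌋ with hd
  have hb0 : (2 : ℝ) ≤ b := by exact_mod_cast hb
  have hbp : (0 : ℝ) < b := by linarith
  have x0 : ∀ n, 0 ≤ x n := fun n => Int.fract_nonneg _
  have x1 : ∀ n, x n < 1 := fun n => Int.fract_lt_one _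
  have dx : ∀ n, d n = ⌊(b : ℝ) * x n⌋ := fun n => rfl
  have xrec : ∀ n, (b : ℝ) * x n = d n + x (n + 1) := by
    intro n
    have e : x (n + 1) = Int.fract ((b : ℝ) * x n) := by
      simp only [hx]
      rw [Int.fract_eq_fract]
      refine ⟨b * ⌊ξ * (b : ℝ) ^ n⌋, ?_⟩
      push_cast
      rw [Int.fract]
      ring
    rw [e, dx]
    exact (Int.floor_add_fract _).symm
  have dge : ∀ n, 0 ≤ d n := fun n => Int.floor_nonneg.2 (mul_nonneg hbp.le (x0 n))
  have dlt : ∀ n, d n ≤ (b : ℤ) - 1 := by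
    intro n
    have : d n < (b : ℤ) := by
      rw [dx, Int.floor_lt]
      push_cast
      nlinarith [x1 n]
    omega
  have hdist : ∀ m n, m < n → x m ≠ x n := by
    intro m n hmn h
    simp only [hx] at h
    rw [Int.fract_eq_fract] at h
    obtain ⟨z, hz⟩ := h
    have hpow : (b : ℝ) ^ m - (b : ℝ) ^ n ≠ 0 := by
      have : (b : ℝ) ^ m < (b : ℝ) ^ n := pow_lt_pow_right₀ (by linarith) hmn
      linarith
    apply hξ
    refine ⟨(z : ℚ) / ((b : ℚ) ^ m - (b : ℚ) ^ n), ?_⟩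
    push_cast
    rw [div_eq_iff hpow, ← hz]
    ring
  have scale : ∀ l m n, (∀ l' < l, d (m + l') = d (n + l')) →
      x (m + l) - x (n + l) = (b : ℝ) ^ l * (x m - x n) := by
    intro l
    induction l with
    | zero => intro m n _; simp
    | succ l ih =>
      intro m n h
      have e1 := ih m n (fun l' hl' => h l' (by omega))
      have e2 := xrec (m + l)
      have e3 := xrec (n + l)
      rw [h l (by omega)] at e2
      rw [pow_succ, ← add_assoc, ← add_assoc]
      linear_combination e3 - e2 + (b : ℝ) * e1
  have lex : ∀ l m n, (∀ l' < l, d (m + l') = d (n + l')) → x m ≤ x n →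
      d (m + l) ≤ d (n + l) := by
    intro l m n h hmn
    have e := scale l m n h
    have : (b : ℝ) ^ l * (x m - x n) ≤ 0 :=
      mul_nonpos_of_nonneg_of_nonpos (by positivity) (by linarith)
    rw [dx, dx]
    apply Int.floor_le_floor
    apply mul_le_mul_of_nonneg_left _ hbp.le
    linarith
  have xeq : ∀ m n, (∀ l, d (m + l) = d (n + l)) → x m = x n := by
    intro m n h
    by_contra hne
    have hpos : 0 < |x m - x n| := abs_pos.2 (sub_ne_zero.2 hne)
    obtain ⟨l, hl⟩ := pow_unbounded_of_one_lt (1 / |x m - x n|) (show (1 : ℝ) < b by linarith)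
    rw [div_lt_iff₀ hpos] at hl
    have e := scale l m n (fun l' _ => h l')
    have : |x (m + l) - x (n + l)| < 1 := by
      rw [abs_lt]
      constructor <;> linarith [x0 (m + l), x1 (m + l), x0 (n + l), x1 (n + l)]
    rw [e, abs_mul, abs_of_pos (by positivity : (0 : ℝ) < (b : ℝ) ^ l)] at this
    linarith
  have hap : ∀ i q, 1 ≤ q → ¬ ∀ r, d (i + r) = d (i + r + q) := by
    intro i q hq h
    refine hdist i (i + q) (by omega) (xeq _ _ fun l => ?_)
    rw [h l]
    congr 1
    omega
  constructor
  · rintro ⟨t, ht⟩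
    have ht : ∀ n, x n ∈ Set.Icc t (t + 1 / b) := ht
    have ht1 : ∀ n, (b : ℝ) * t ≤ b * x n := fun n => mul_le_mul_of_nonneg_left (ht n).1 hbp.le
    have ht2 : ∀ n, (b : ℝ) * x n ≤ b * t + 1 := by
      intro n
      have := mul_le_mul_of_nonneg_left (ht n).2 hbp.le
      rwa [mul_add, mul_one_div_cancel hbp.ne'] at this
    obtain ⟨k, hk⟩ : ∃ k, k = ⌊(b : ℝ) * t⌋ := ⟨_, rfl⟩
    have hab : ∀ n, d n = k ∨ d n = k + 1 := by
      intro n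
      have l1 : k ≤ d n := by rw [hk]; exact Int.floor_le_floor (ht1 n)
      have l2 : d n < k + 2 := by
        rw [dx, Int.floor_lt]
        push_cast
        have := Int.lt_floor_add_one ((b : ℝ) * t)
        rw [← hk] at this
        linarith [ht2 n]
      omega
    have exk : ∃ n, d n = k := by
      by_contra h
      push Not at h
      refine hap 0 1 le_rfl fun r => ?_
      rw [(hab _).resolve_left (h _), (hab _).resolve_left (h _)]
    have exk1 : ∃ n, d n = k + 1 := by
      by_contra h
      push Not at h
      refine hap 0 1 le_rfl fun r => ?_
      rw [(hab _).resolve_right (h _), (hab _).resolve_right (h _)]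
    obtain ⟨n0, hn0⟩ := exk
    obtain ⟨n1, hn1⟩ := exk1
    have hord : ∀ i j, d i = k → d j = k + 1 → x (j + 1) ≤ x (i + 1) := by
      intro i j hi hj
      have e1 := xrec i
      have e2 := xrec j
      rw [hi] at e1
      rw [hj] at e2
      push_cast at e2
      linarith [ht1 i, ht2 j]
    refine ⟨k, by rw [← hn0]; exact dge _, by have := dlt n1; omega, hab, ?_⟩
    have hls : ∀ m i j i' j', d i = k → d j = k + 1 → d i' = k → d j' = k + 1 →
        window d (i + 1) m = window d (j + 1) m → window d (i' + 1) m = window d (j' + 1) m →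
        window d (i + 1) m = window d (i' + 1) m := by
      intro m i j i' j' hi hj hi' hj' h h'
      rw [win_eq] at h h' ⊢
      intro l
      induction l using Nat.strong_induction_on with
      | _ l ih =>
        intro hl
        have a1 := lex l (j + 1) (i' + 1) (fun l' hl' => by
          rw [← h l' (by omega), ih l' hl' (by omega)]) (hord i' j hi' hj)
        have a2 := lex l (j' + 1) (i + 1) (fun l' hl' => by
          rw [← h' l' (by omega), ih l' hl' (by omega)]) (hord i j' hi hj')
        rw [← h l hl] at a1
        rw [← h' l hl] at a2
        exact le_antisymm a1 a2
    have hcm : ∀ m, complexity d m = m + 1 := by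
      intro m
      induction m with
      | zero => exact cpl_zero d
      | succ m ih =>
        have u1 := cpl_lt d k (k + 1) hab hap m
        have u2 := cpl_le d k (k + 1) hab m (hls m)
        omega
    exact fun m _ => hcm m
  · rintro ⟨k, _, _, hab, hcm⟩
    have hab : ∀ n, d n = k ∨ d n = k + 1 := hab
    have hcm' : ∀ m, complexity d m = m + 1 := by
      intro m
      rcases Nat.eq_zero_or_pos m with h | h
      · subst h; exact cpl_zero d
      · exact hcm m h
    have hord : ∀ i j, d i = k → d j = k + 1 → x (j + 1) ≤ x (i + 1) := by
      intro i j hi hj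
      by_contra hlt
      push Not at hlt
      have hex : ∃ l, d (i + 1 + l) ≠ d (j + 1 + l) := by
        by_contra h
        push Not at h
        exact hlt.ne (xeq _ _ h)
      classical
      have hs := Nat.find_spec hex
      have hm : ∀ l < Nat.find hex, d (i + 1 + l) = d (j + 1 + l) := fun l hl => by
        simpa using Nat.find_min hex hl
      have hl := lex _ _ _ hm hlt.le
      have := hab (i + 1 + Nat.find hex)
      have := hab (j + 1 + Nat.find hex)
      exact no_pair d k hab hcm' hap i j (Nat.find hex) hi hj hm (by omega) (by omega)
    set C : Set ℝ := {y | ∃ j, d j = k + 1 ∧ x (j + 1) = y} with hC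
    have hbdd : BddAbove C := ⟨1, by rintro _ ⟨j, _, rfl⟩; exact (x1 _).le⟩
    have c0 : 0 ≤ sSup C := Real.sSup_nonneg (by rintro _ ⟨j, _, rfl⟩; exact x0 _)
    have c1 : sSup C ≤ 1 := Real.sSup_le (by rintro _ ⟨j, _, rfl⟩; exact (x1 _).le) zero_le_one
    refine ⟨(k + sSup C) / b, fun n => ?_⟩
    show x n ∈ _
    rw [← add_div, Set.mem_Icc, div_le_iff₀ hbp, le_div_iff₀ hbp, mul_comm (x n), xrec n]
    rcases hab n with h | h
    · have : sSup C ≤ x (n + 1) :=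
        Real.sSup_le (by rintro _ ⟨j, hj, rfl⟩; exact hord n j h hj) (x0 _)
      rw [h]
      constructor <;> linarith [x1 (n + 1)]
    · have : x (n + 1) ≤ sSup C := le_csSup hbdd ⟨n, h, rfl⟩
      rw [h]
      push_cast
      constructor <;> linarith [x0 (n + 1)]
end
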